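/- Fix an integer n ≥ 2. Any two n-clique tree-graded right-angled Artin groups are quasi-isometric: if Γ and Λ are n-clique tree-graded graphs, then A(Γ) and A(Λ) are quasi-isometric. -/

import Mathlib

noncomputable section

universe u v

/-- Word metric (distance function) on a group with respect to a generating set `S`. -/
def wordDist {G : Type*} [Group G] (S : Set G) (g h : G) : ℝ :=
  sInf ((fun l : List G => (l.length : ℝ)) ''
    {l : List G | (∀ x ∈ l, x ∈ S ∨ x⁻¹ ∈ S) ∧ g * l.prod = h})

/-- `f` is `(K, A)`-coarse Lipschitz. -/
def CoarseLipschitzWith {X Y : Type*} (K A : ℝ) (dX : X → X → ℝ) (dY : Y → Y → ℝ)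
    (f : X → Y) : Prop :=
  ∀ x x', dY (f x) (f x') ≤ K * dX x x' + A

/-- `f` is a `(K, A)`-quasi-isometry. -/
def IsQIWith {X Y : Type*} (K A : ℝ) (dX : X → X → ℝ) (dY : Y → Y → ℝ) (f : X → Y) : Prop :=
  1 ≤ K ∧ 0 ≤ A ∧
  (∀ x x', dX x x' / K - A ≤ dY (f x) (f x') ∧ dY (f x) (f x') ≤ K * dX x x' + A) ∧
  (∀ y, ∃ x, dY (f x) y ≤ A)

/-- `f` is a quasi-isometry. -/
def IsQI {X Y : Type*} (dX : X → X → ℝ) (dY : Y → Y → ℝ) (f : X → Y) : Prop :=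
  ∃ K A : ℝ, IsQIWith K A dX dY f

/-- The Hausdorff distance between `S` and `T` (w.r.t. the distance `d`) is at most `r`. -/
def HausLE {X : Type*} (d : X → X → ℝ) (S T : Set X) (r : ℝ) : Prop :=
  (∀ s ∈ S, ∃ t ∈ T, d s t ≤ r) ∧ (∀ t ∈ T, ∃ s ∈ S, d s t ≤ r)

/-- `S` and `T` are at finite Hausdorff distance. -/
def FinHaus {X : Type*} (d : X → X → ℝ) (S T : Set X) : Prop :=
  ∃ r : ℝ, 0 ≤ r ∧ HausLE d S T r

/-- The commutator relations of a right-angled Artin group. -/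
def raagRels {V : Type} (Γ : SimpleGraph V) : Set (FreeGroup V) :=
  {r | ∃ x y : V, Γ.Adj x y ∧
    r = FreeGroup.of x * FreeGroup.of y * (FreeGroup.of x)⁻¹ * (FreeGroup.of y)⁻¹}

/-- The right-angled Artin group `A(Γ)` of a simplicial graph `Γ`. -/
abbrev Raag {V : Type} (Γ : SimpleGraph V) : Type := PresentedGroup (raagRels Γ)

/-- The generator of `Raag Γ` corresponding to a vertex. -/
def raagGen {V : Type} (Γ : SimpleGraph V) (x : V) : Raag Γ :=
  PresentedGroup.of (rels := raagRels Γ) x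

/-- The word metric on `Raag Γ` with respect to the vertex generators. -/
def raagDist {V : Type} (Γ : SimpleGraph V) : Raag Γ → Raag Γ → ℝ :=
  wordDist (Set.range (raagGen Γ))

/-- `A(Γ)` and `A(Λ)` are quasi-isometric (w.r.t. the vertex word metrics). -/
def RaagQI {V W : Type} (Γ : SimpleGraph V) (Λ : SimpleGraph W) : Prop :=
  ∃ f : Raag Γ → Raag Λ, IsQI (raagDist Γ) (raagDist Λ) f

/-- A standard geodesic: the coset `g⟨v⟩`, recorded by a basepoint `g` and a label `v`. -/
structure StdGeod {V : Type} (Γ : SimpleGraph V) where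
  base : Raag Γ
  label : V

/-- The parametrization `n ↦ g vⁿ` of a standard geodesic, identifying it with `ℤ`. -/
def StdGeod.param {V : Type} {Γ : SimpleGraph V} (l : StdGeod Γ) : ℤ → Raag Γ :=
  fun n => l.base * raagGen Γ l.label ^ n

/-- The underlying subset of a standard geodesic. -/
def StdGeod.carrier {V : Type} {Γ : SimpleGraph V} (l : StdGeod Γ) : Set (Raag Γ) :=
  Set.range l.param

/-- Two standard geodesics are parallel if they are at finite Hausdorff distance. -/
def Parallel {V : Type} {Γ : SimpleGraph V} (l k : StdGeod Γ) : Prop :=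
  FinHaus (raagDist Γ) l.carrier k.carrier

/-- A based quasi-isometry `(A(Γ), l) → (A(Λ), l')`. -/
def IsBasedQI {V W : Type} {Γ : SimpleGraph V} {Λ : SimpleGraph W}
    (f : Raag Γ → Raag Λ) (l : StdGeod Γ) (l' : StdGeod Λ) : Prop :=
  IsQI (raagDist Γ) (raagDist Λ) f ∧ FinHaus (raagDist Λ) (f '' l.carrier) l'.carrier

/-- `str(f, l, C) = r`: on `l`, the map `f` is `C`-close to `n ↦ ±⌊r n⌋ + b`
(read through the identifications of `l` and `l'` with `ℤ`). -/
def StrWith {V W : Type} {Γ : SimpleGraph V} {Λ : SimpleGraph W}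
    (f : Raag Γ → Raag Λ) (l : StdGeod Γ) (l' : StdGeod Λ) (C : ℝ) (r : ℚ) : Prop :=
  ∃ ε : ℤ, (ε = 1 ∨ ε = -1) ∧ ∃ b : ℤ,
    ∀ n : ℤ, raagDist Λ (f (l.param n)) (l'.param (ε * ⌊r * (n : ℚ)⌋ + b)) ≤ C

/-- The stretch factor `str(f, l)` (computed with respect to `l'`) is well-defined
and equals `r`. -/
def HasStr {V W : Type} {Γ : SimpleGraph V} {Λ : SimpleGraph W}
    (f : Raag Γ → Raag Λ) (l : StdGeod Γ) (l' : StdGeod Λ) (r : ℚ) : Prop :=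
  ∃ C : ℝ, 0 ≤ C ∧ StrWith f l l' C r

/-- `l` is an `𝓡`-geodesic. -/
def IsRGeod {V : Type} {Γ : SimpleGraph V} (l : StdGeod Γ) : Prop :=
  ∀ (W : Type) [Fintype W] (Λ : SimpleGraph W) (l' : StdGeod Λ)
    (f g : Raag Γ → Raag Λ),
    IsBasedQI f l l' → IsBasedQI g l l' →
    ∃ r : ℚ, HasStr f l l' r ∧ HasStr g l l' r

/-- The parallelism class `𝒮_l` of a standard geodesic (as a family of subsets). -/
def parClass {V : Type} {Γ : SimpleGraph V} (l : StdGeod Γ) : Set (Set (Raag Γ)) :=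
  {S | ∃ k : StdGeod Γ, S = k.carrier ∧ Parallel l k}

/-- The peripheral structure `𝒫_B` on `Raag Γ` determined by a set `B` of vertices. -/
def periph {V : Type} (Γ : SimpleGraph V) (B : Set V) : Set (Set (Set (Raag Γ))) :=
  {F | ∃ l : StdGeod Γ, l.label ∈ B ∧ F = parClass l}

/-- A `(K, A)`-relative quasi-isometry between spaces with peripheral structures. -/
def IsRelQIWith {X Y : Type*} (K A : ℝ) (dX : X → X → ℝ) (dY : Y → Y → ℝ)
    (PX : Set (Set (Set X))) (PY : Set (Set (Set Y)))
    (f : X → Y) (fs : Set (Set X) → Set (Set Y)) : Prop :=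
  IsQIWith K A dX dY f ∧
  Set.BijOn fs PX PY ∧
  ∀ F ∈ PX, (∀ a ∈ F, ∃ b ∈ fs F, HausLE dY (f '' a) b A) ∧
            (∀ b ∈ fs F, ∃ a ∈ F, HausLE dY (f '' a) b A)

/-- The two spaces with peripheral structures are relatively quasi-isometric. -/
def IsRelQI {X Y : Type*} (dX : X → X → ℝ) (dY : Y → Y → ℝ)
    (PX : Set (Set (Set X))) (PY : Set (Set (Set Y))) : Prop :=
  ∃ (K A : ℝ) (f : X → Y) (fs : Set (Set X) → Set (Set Y)),
    IsRelQIWith K A dX dY PX PY f fs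

/-- Left translation of a family of subsets of `Raag Γ`. -/
def translateFam {V : Type} {Γ : SimpleGraph V} (g : Raag Γ) (F : Set (Set (Raag Γ))) :
    Set (Set (Raag Γ)) :=
  (fun a => (fun x => g * x) '' a) '' F

/-- A decoration on `𝒫_B` that is invariant under the left translation action. -/
def DecorInvariant {V : Type} (Γ : SimpleGraph V) (B : Set V) {O : Type}
    (δ : Set (Set (Raag Γ)) → O) : Prop :=
  ∀ g : Raag Γ, ∀ F ∈ periph Γ B, δ (translateFam g F) = δ F

/-- A decoration-preserving based relative quasi-isometry
`(A(Γ), 𝒫_{BΓ}, δΓ, l) → (A(Λ), 𝒫_{BΛ}, δΛ, l')`. -/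
def IsDecorBasedRelQI {V W : Type} (Γ : SimpleGraph V) (Λ : SimpleGraph W)
    (BΓ : Set V) (BΛ : Set W) {O : Type}
    (δΓ : Set (Set (Raag Γ)) → O) (δΛ : Set (Set (Raag Λ)) → O)
    (l : StdGeod Γ) (l' : StdGeod Λ)
    (f : Raag Γ → Raag Λ) (fs : Set (Set (Raag Γ)) → Set (Set (Raag Λ))) : Prop :=
  (∃ K A : ℝ, IsRelQIWith K A (raagDist Γ) (raagDist Λ) (periph Γ BΓ) (periph Λ BΛ) f fs) ∧
  (∀ F ∈ periph Γ BΓ, δΛ (fs F) = δΓ F) ∧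
  FinHaus (raagDist Λ) (f '' l.carrier) l'.carrier

/-- `A(Γ)` is a dovetail RAAG. -/
def Dovetail {V : Type} (Γ : SimpleGraph V) : Prop :=
  ∀ (W : Type) [Fintype W] (Λ : SimpleGraph W) (BΓ : Set V) (BΛ : Set W)
    (O : Type) (δΓ : Set (Set (Raag Γ)) → O) (δΛ : Set (Set (Raag Λ)) → O),
    DecorInvariant Γ BΓ δΓ → DecorInvariant Λ BΛ δΛ →
    ∀ (l : StdGeod Γ) (l' : StdGeod Λ) (f : Raag Γ → Raag Λ)
      (fs : Set (Set (Raag Γ)) → Set (Set (Raag Λ))),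
      IsDecorBasedRelQI Γ Λ BΓ BΛ δΓ δΛ l l' f fs →
      ∀ lam : Set (Set (Raag Γ)) → ℚ,
        (∀ F ∈ periph Γ BΓ, 0 < lam F) →
        (∃ M : ℚ, 1 ≤ M ∧ ∀ F ∈ periph Γ BΓ, 1 / M ≤ lam F ∧ lam F ≤ M) →
        (∀ F ∈ periph Γ BΓ, ∀ F' ∈ periph Γ BΓ, δΓ F = δΓ F' → lam F = lam F') →
        ∃ C : ℝ, 0 ≤ C ∧
          ∃ (g : Raag Γ → Raag Λ) (gs : Set (Set (Raag Γ)) → Set (Set (Raag Λ))),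
            IsDecorBasedRelQI Γ Λ BΓ BΛ δΓ δΛ l l' g gs ∧
            (∀ l2 : StdGeod Γ, l2.label ∈ BΓ → ¬ IsRGeod l2 →
              ∀ l3 : StdGeod Λ, FinHaus (raagDist Λ) (g '' l2.carrier) l3.carrier →
                StrWith g l2 l3 C (lam (parClass l2))) ∧
            (∀ l2 : StdGeod Γ, l2.label ∈ BΓ → IsRGeod l2 →
              ∀ l3 : StdGeod Λ, FinHaus (raagDist Λ) (g '' l2.carrier) l3.carrier →
                ∃ r : ℚ, StrWith g l2 l3 C r)

/-- The closed star of a vertex, as a vertex set. -/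
def starSet {V : Type} (Γ : SimpleGraph V) (x : V) : Set V :=
  insert x {u | Γ.Adj x u}

/-- The link of a vertex, as a vertex set. -/
def lkSet {V : Type} (Γ : SimpleGraph V) (x : V) : Set V := {u | Γ.Adj x u}

/-- The link of `x` inside the induced subgraph on `S`. -/
def lkIn {V : Type} (Γ : SimpleGraph V) (S : Set V) (x : V) : Set V :=
  {u | u ∈ S ∧ Γ.Adj x u}

/-- `x` is a cut vertex: deleting it (and incident edges) disconnects the graph. -/
def CutVertex {V : Type} (Γ : SimpleGraph V) (x : V) : Prop :=
  ¬ (Γ.induce {u : V | u ≠ x}).Preconnected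

/-- The vertex set `S` spans a biconnected subgraph: connected with no cut vertex. -/
def Biconn {V : Type} (Γ : SimpleGraph V) (S : Set V) : Prop :=
  (Γ.induce S).Connected ∧ ∀ x ∈ S, (Γ.induce (S \ {x})).Preconnected

/-- `S` spans a maximal biconnected subgraph. -/
def MaxBiconn {V : Type} (Γ : SimpleGraph V) (S : Set V) : Prop :=
  Biconn Γ S ∧ ∀ T : Set V, Biconn Γ T → S ⊆ T → S = T

/-- The collection `C₁` of maximal biconnected subgraphs: those containing at least
two cut vertices, or not contained in the star of any cut vertex. -/
def C1 {V : Type} (Γ : SimpleGraph V) : Set (Set V) :=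
  {S | MaxBiconn Γ S ∧
    ((∃ x ∈ S, ∃ y ∈ S, x ≠ y ∧ CutVertex Γ x ∧ CutVertex Γ y) ∨
     (∀ x : V, CutVertex Γ x → ¬ S ⊆ starSet Γ x))}

/-- `Γ` is an `n`-clique tree-graded graph. -/
def NCliqueTreeGraded {V : Type} (Γ : SimpleGraph V) (n : ℕ) : Prop :=
  Γ.Connected ∧
  (∀ x : V, CutVertex Γ x ∨ (∃! u : V, Γ.Adj x u)) ∧
  (∃ x y : V, 3 ≤ Γ.dist x y) ∧
  (∀ S : Set V, MaxBiconn Γ S →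
    ((Γ.IsClique S ∧ S.ncard = n ∧ ∀ x ∈ S, CutVertex Γ x) ∨
     (Γ.IsClique S ∧ S.ncard = 2 ∧ ∃! x : V, x ∈ S ∧ CutVertex Γ x)))

/-- The subgroup of `Raag Γ` generated by the vertices in `T`. -/
def subRaag {V : Type} (Γ : SimpleGraph V) (T : Set V) : Subgroup (Raag Γ) :=
  Subgroup.closure (raagGen Γ '' T)

/-- The word metric on the subgroup generated by `T`, w.r.t. the generators from `T`. -/
def subDist {V : Type} (Γ : SimpleGraph V) (T : Set V) :
    ↥(subRaag Γ T) → ↥(subRaag Γ T) → ℝ :=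
  wordDist {x : ↥(subRaag Γ T) | ∃ u ∈ T, (x : Raag Γ) = raagGen Γ u}

/-- The cylinder group `A(star(x))`. -/
def cylGroup {V : Type} (Γ : SimpleGraph V) (x : V) : Subgroup (Raag Γ) :=
  subRaag Γ (starSet Γ x)

/-- The word metric on the cylinder `A(star(x))` w.r.t. the vertices of `star(x)`. -/
def cylDist {V : Type} (Γ : SimpleGraph V) (x : V) :
    ↥(cylGroup Γ x) → ↥(cylGroup Γ x) → ℝ :=
  subDist Γ (starSet Γ x)

/-- The coset `a⟨x⟩`, as a subset of the cylinder `A(star(x))`. -/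
def cylCoset {V : Type} (Γ : SimpleGraph V) (x : V) (a : Raag Γ) :
    Set ↥(cylGroup Γ x) :=
  {g | ∃ n : ℤ, (g : Raag Γ) = a * raagGen Γ x ^ n}

/-- The peripheral structure `𝒫_x` on the cylinder `A(star(x))`: one element for each
coset `g·A(star_{Γ'}(x))` with `Γ' ∈ C₁` containing `x`, namely the family of cosets
`{g·h·⟨x⟩ : h ∈ A(lk_{Γ'}(x))}`. -/
def cylPeriph {V : Type} (Γ : SimpleGraph V) (x : V) :
    Set (Set (Set ↥(cylGroup Γ x))) :=
  {F | ∃ S ∈ C1 Γ, x ∈ S ∧ ∃ g : Raag Γ, g ∈ cylGroup Γ x ∧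
    F = {c | ∃ h ∈ subRaag Γ (lkIn Γ S x), c = cylCoset Γ x (g * h)}}

/-- The factors `A(T) ≤ A(Γ)` and `A(T') ≤ A(Λ)` are quasi-isometric. -/
def FactorQI {V W : Type} (Γ : SimpleGraph V) (Λ : SimpleGraph W)
    (T : Set V) (T' : Set W) : Prop :=
  ∃ φ : ↥(subRaag Γ T) → ↥(subRaag Λ T'), IsQI (subDist Γ T) (subDist Λ T') φ

/-- `Near r k x y`: the points `x` and `y` are joined by a path of length at most `k` in the
graph whose edges are the `r`-related pairs. -/
def Near {α : Type*} (r : α → α → Prop) : ℕ → α → α → Prop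
  | 0, x, y => x = y
  | k + 1, x, y => ∃ z, Near r k x z ∧ (z = y ∨ r z y ∨ r y z)

namespace Near

variable {α β : Type*} {r : α → α → Prop} {s : β → β → Prop}

theorem succ {k : ℕ} {x y : α} (h : Near r k x y) : Near r (k + 1) x y :=
  ⟨y, h, Or.inl rfl⟩

theorem mono {k l : ℕ} (hkl : k ≤ l) {x y : α} (h : Near r k x y) : Near r l x y := by
  induction hkl with
  | refl => exact h
  | step _ ih => exact ih.succ

theorem refl (r : α → α → Prop) (k : ℕ) (x : α) : Near r k x x :=
  mono (Nat.zero_le k) (show Near r 0 x x from rfl)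

theorem of_rel {x y : α} (h : r x y) : Near r 1 x y :=
  ⟨x, rfl, Or.inr (Or.inl h)⟩

theorem trans {k l : ℕ} {x y z : α} (h : Near r k x y) (h' : Near r l y z) :
    Near r (k + l) x z := by
  induction l generalizing z with
  | zero => cases h'; exact h
  | succ l ih =>
    obtain ⟨w, hw, hwz⟩ := h'
    exact ⟨w, ih hw, hwz⟩

theorem symm {k : ℕ} {x y : α} (h : Near r k x y) : Near r k y x := by
  induction k generalizing y with
  | zero => exact Eq.symm h
  | succ k ih =>
    obtain ⟨z, hz, hzy⟩ := h
    have h1 : Near r 1 y z := ⟨y, rfl, by tauto⟩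
    exact (h1.trans (ih hz)).mono (by omega)

theorem map {φ : α → β} {C : ℕ} (hφ : ∀ x y, r x y → Near s C (φ x) (φ y)) {k : ℕ} {x y : α}
    (h : Near r k x y) : Near s (C * k) (φ x) (φ y) := by
  induction k generalizing y with
  | zero => cases h; exact refl _ _ _
  | succ k ih =>
    obtain ⟨z, hz, hzy⟩ := h
    rcases hzy with rfl | hzy | hzy
    · exact (ih hz).mono (Nat.mul_le_mul_left _ (Nat.le_succ k))
    · exact (ih hz).trans (hφ _ _ hzy)
    · exact (ih hz).trans (hφ _ _ hzy).symm

end Near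

/-- Two graphs, given by their edge relations, are coarsely equivalent: there are coarsely
Lipschitz maps in both directions which are coarsely inverse to each other. -/
def CoarseEquiv {α β : Type*} (r : α → α → Prop) (s : β → β → Prop) : Prop :=
  ∃ (φ : α → β) (ψ : β → α) (C : ℕ),
    (∀ x y, r x y → Near s C (φ x) (φ y)) ∧ (∀ x y, s x y → Near r C (ψ x) (ψ y)) ∧
    (∀ x, Near r C (ψ (φ x)) x) ∧ (∀ y, Near s C (φ (ψ y)) y)

namespace CoarseEquiv

variable {α β γ : Type*} {r : α → α → Prop} {s : β → β → Prop} {t : γ → γ → Prop}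

theorem symm (h : CoarseEquiv r s) : CoarseEquiv s r := by
  obtain ⟨φ, ψ, C, h1, h2, h3, h4⟩ := h
  exact ⟨ψ, φ, C, h2, h1, h4, h3⟩

theorem trans (h : CoarseEquiv r s) (h' : CoarseEquiv s t) : CoarseEquiv r t := by
  obtain ⟨φ, ψ, C, h1, h2, h3, h4⟩ := h
  obtain ⟨φ', ψ', C', h1', h2', h3', h4'⟩ := h'
  refine ⟨φ' ∘ φ, ψ ∘ ψ', C * C' + C + C', fun x y h => ?_, fun x y h => ?_, fun x => ?_,
    fun y => ?_⟩
  · exact ((h1 x y h).map h1').mono (by nlinarith)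
  · exact ((h2' x y h).map h2).mono (by nlinarith)
  · exact (((h3' (φ x)).map h2).trans (h3 x)).mono (by nlinarith)
  · exact (((h4 (ψ' y)).map h1').trans (h4' y)).mono (by nlinarith)

end CoarseEquiv

/-- The edge relation of the Cayley graph of `A(Γ)`. -/
def cayleyRel {V : Type} (Γ : SimpleGraph V) (g h : Raag Γ) : Prop :=
  ∃ v, h = g * raagGen Γ v

section WordMetric

variable {V W : Type} {Γ : SimpleGraph V} {Λ : SimpleGraph W}

theorem exists_list_of_near {k : ℕ} {g h : Raag Γ} (H : Near (cayleyRel Γ) k g h) :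
    ∃ l : List (Raag Γ), (∀ x ∈ l, x ∈ Set.range (raagGen Γ) ∨ x⁻¹ ∈ Set.range (raagGen Γ)) ∧
      g * l.prod = h ∧ l.length ≤ k := by
  induction k generalizing h with
  | zero => cases H; exact ⟨[], by simp⟩
  | succ k ih =>
    obtain ⟨z, hz, hzh⟩ := H
    obtain ⟨l, hl, hlz, hlk⟩ := ih hz
    rcases hzh with rfl | ⟨v, rfl⟩ | ⟨v, rfl⟩
    · exact ⟨l, hl, hlz, by omega⟩
    · refine ⟨l ++ [raagGen Γ v], ?_, by simp [← hlz, mul_assoc], by simpa using hlk⟩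
      intro x hx
      rcases List.mem_append.1 hx with hx | hx
      · exact hl x hx
      · rw [List.mem_singleton.1 hx]
        exact Or.inl ⟨v, rfl⟩
    · refine ⟨l ++ [(raagGen Γ v)⁻¹], ?_, by simp [← mul_assoc, hlz], by simpa using hlk⟩
      intro x hx
      rcases List.mem_append.1 hx with hx | hx
      · exact hl x hx
      · rw [List.mem_singleton.1 hx, inv_inv]
        exact Or.inr ⟨v, rfl⟩

theorem near_of_list {g : Raag Γ} (l : List (Raag Γ))
    (hl : ∀ x ∈ l, x ∈ Set.range (raagGen Γ) ∨ x⁻¹ ∈ Set.range (raagGen Γ)) :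
    Near (cayleyRel Γ) l.length g (g * l.prod) := by
  induction l generalizing g with
  | nil => simp [Near]
  | cons x l ih =>
    have h1 : Near (cayleyRel Γ) 1 g (g * x) := by
      rcases hl x (by simp) with ⟨v, rfl⟩ | ⟨v, hv⟩
      · exact Near.of_rel ⟨v, rfl⟩
      · refine (Near.of_rel ⟨v, ?_⟩).symm
        rw [hv]; group
    have h2 := h1.trans (ih (g := g * x) fun y hy => hl y (by simp [hy]))
    rw [List.prod_cons, ← mul_assoc]
    exact h2.mono (by simp [add_comm])

theorem cayley_connected (g h : Raag Γ) : ∃ k, Near (cayleyRel Γ) k g h := by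
  suffices H : ∀ x g : Raag Γ, ∃ k, Near (cayleyRel Γ) k g (g * x) by
    simpa using H (g⁻¹ * h) g
  intro x
  have hx : x ∈ Subgroup.closure (Set.range (raagGen Γ)) := by
    have := PresentedGroup.closure_range_of (raagRels Γ)
    exact this ▸ Subgroup.mem_top x
  induction hx using Subgroup.closure_induction with
  | mem x hx =>
    obtain ⟨v, rfl⟩ := hx
    exact fun g => ⟨1, Near.of_rel ⟨v, rfl⟩⟩
  | one => exact fun g => ⟨0, by simp [Near]⟩
  | mul x y _ _ hx hy =>
    intro g
    obtain ⟨k, hk⟩ := hx g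
    obtain ⟨l, hl⟩ := hy (g * x)
    exact ⟨k + l, by simpa [mul_assoc] using hk.trans hl⟩
  | inv x _ hx =>
    intro g
    obtain ⟨k, hk⟩ := hx (g * x⁻¹)
    exact ⟨k, by simpa using hk.symm⟩

theorem raagDist_le {k : ℕ} {g h : Raag Γ} (H : Near (cayleyRel Γ) k g h) :
    raagDist Γ g h ≤ k := by
  obtain ⟨l, hl, hgl, hlk⟩ := exists_list_of_near H
  have h : raagDist Γ g h ≤ l.length := by
    refine csInf_le ⟨0, ?_⟩ ⟨l, ⟨hl, hgl⟩, rfl⟩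
    rintro _ ⟨l, -, rfl⟩
    exact Nat.cast_nonneg _
  exact h.trans (by exact_mod_cast hlk)

theorem exists_near_raagDist_eq (g h : Raag Γ) :
    ∃ k : ℕ, raagDist Γ g h = k ∧ Near (cayleyRel Γ) k g h := by
  classical
  have hex := cayley_connected g h
  refine ⟨Nat.find hex, le_antisymm (raagDist_le (Nat.find_spec hex)) ?_, Nat.find_spec hex⟩
  obtain ⟨l, hl, hgl, -⟩ := exists_list_of_near (Nat.find_spec hex)
  refine le_csInf ⟨_, l, ⟨hl, hgl⟩, rfl⟩ ?_
  rintro _ ⟨l, ⟨hl, hgl⟩, rfl⟩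
  have := near_of_list (g := g) l hl
  rw [hgl] at this
  exact Nat.cast_le.2 (Nat.find_min' hex this)

theorem raagQI_of_coarseEquiv (H : CoarseEquiv (cayleyRel Γ) (cayleyRel Λ)) : RaagQI Γ Λ := by
  obtain ⟨φ, ψ, C, h1, h2, h3, h4⟩ := H
  have hC : (0 : ℝ) ≤ C := Nat.cast_nonneg C
  refine ⟨φ, C + 1, 2 * C, by linarith, by linarith, fun x y => ⟨?_, ?_⟩, fun y => ⟨ψ y, ?_⟩⟩
  · obtain ⟨k, hk, hxy⟩ := exists_near_raagDist_eq (φ x) (φ y)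
    have h := raagDist_le (((h3 x).symm.trans (hxy.map h2)).trans (h3 y))
    rw [hk, sub_le_iff_le_add, div_le_iff₀ (by linarith)]
    push_cast at h
    nlinarith [(Nat.cast_nonneg k : (0 : ℝ) ≤ k)]
  · obtain ⟨k, hk, hxy⟩ := exists_near_raagDist_eq x y
    have h := raagDist_le (hxy.map h1)
    rw [hk]
    push_cast at h
    nlinarith [(Nat.cast_nonneg k : (0 : ℝ) ≤ k)]
  · exact (raagDist_le (h4 y)).trans (by linarith)

end WordMetric

/-- A line of `ℤⁿ` parallel to a coordinate axis, recorded by its point with vanishing coordinate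
along that axis. -/
@[ext] structure Line (n : ℕ) where
  axis : Fin n
  pt : Fin n → ℤ
  pt_axis : pt axis = 0

namespace Line

variable {n : ℕ}

/-- The point of a line with prescribed coordinate along its axis. -/
def at' (L : Line n) (t : ℤ) : Fin n → ℤ := Function.update L.pt L.axis t

/-- The coordinate axis, as a line. -/
def zero (i : Fin n) : Line n := ⟨i, 0, rfl⟩

theorem zero_at (i : Fin n) (t : ℤ) : (zero i).at' t = Pi.single i t := rfl

variable [Nontrivial (Fin n)]

/-- A coordinate direction different from `i`. -/
def other (i : Fin n) : Fin n := (exists_ne i).choose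

theorem other_ne (i : Fin n) : other i ≠ i := (exists_ne i).choose_spec

/-- The line parallel to the `i`-th axis at distance `s` from it, in a fixed direction. -/
def ray (i : Fin n) (s : ℕ) : Line n :=
  ⟨i, Pi.single (other i) (s : ℤ), Pi.single_eq_of_ne (other_ne i).symm _⟩

theorem ray_injective {i : Fin n} {s t : ℕ} (h : ray i s = ray i t) : s = t := by
  have := congrFun (congrArg Line.pt h) (other i)
  simpa [ray] using this

theorem ray_zero (i : Fin n) : ray i 0 = zero i := by
  simp [ray, zero]

theorem ray_at (i : Fin n) (s : ℕ) (t : ℤ) :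
    (ray i s).at' t = Pi.single i t + Pi.single (other i) (s : ℤ) := by
  funext j
  by_cases hj : j = i
  · subst hj
    simp [at', ray, (other_ne j).symm]
  · simp [at', ray, hj]

/-- The self-injection of the set of lines which moves the lines `ray i s` to
`ray i (s + N + 1)` and fixes all others. -/
def shift (N : ℕ) (L : Line n) : Line n :=
  open Classical in
  if h : ∃ s : ℕ, L = ray L.axis s then ray L.axis (h.choose + N + 1) else L

theorem shift_ray (N : ℕ) (i : Fin n) (s : ℕ) : shift N (ray i s) = ray i (s + N + 1) := by
  have h : ∃ t : ℕ, ray i s = ray (ray i s).axis t := ⟨s, rfl⟩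
  rw [shift, dif_pos h, ← ray_injective (h.choose_spec : ray i s = ray i _)]
  rfl

theorem shift_of_not (N : ℕ) {L : Line n} (h : ¬ ∃ s : ℕ, L = ray L.axis s) : shift N L = L :=
  dif_neg h

theorem shift_cases (N : ℕ) (L : Line n) :
    (∃ s, L = ray L.axis s ∧ shift N L = ray L.axis (s + N + 1)) ∨
      ((∀ i s, L ≠ ray i s) ∧ shift N L = L) := by
  by_cases h : ∃ s : ℕ, L = ray L.axis s
  · obtain ⟨s, hs⟩ := h
    refine Or.inl ⟨s, hs, ?_⟩
    conv_lhs => rw [hs]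
    exact shift_ray N _ s
  · refine Or.inr ⟨fun i s his => h ⟨s, ?_⟩, shift_of_not N h⟩
    subst his
    rfl

theorem shift_axis (N : ℕ) (L : Line n) : (shift N L).axis = L.axis := by
  rcases shift_cases N L with ⟨s, -, h⟩ | ⟨-, h⟩ <;> rw [h]
  rfl

theorem shift_ne_ray (N : ℕ) (L : Line n) (i : Fin n) {s : ℕ} (hs : s ≤ N) :
    shift N L ≠ ray i s := by
  intro h
  rcases shift_cases N L with ⟨t, -, h'⟩ | ⟨hL, h'⟩
  · have hi : L.axis = i := by rw [← shift_axis N L, h]; rfl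
    rw [h', hi] at h
    have := ray_injective h
    omega
  · exact hL i s (h'.symm.trans h)

theorem shift_injective (N : ℕ) : Function.Injective (shift (n := n) N) := by
  intro L L' h
  have ha : L.axis = L'.axis := by rw [← shift_axis N L, h, shift_axis]
  rcases shift_cases N L with ⟨s, hs, h1⟩ | ⟨hL, h1⟩ <;>
    rcases shift_cases N L' with ⟨t, ht, h2⟩ | ⟨hL', h2⟩
  · rw [h1, h2, ha] at h
    have := ray_injective h
    rw [hs, ht, ha, show s = t by omega]
  · exact absurd (by rw [← h2, ← h, h1]) (hL' L.axis (s + N + 1))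
  · exact absurd (by rw [← h1, h, h2]) (hL L'.axis (t + N + 1))
  · rw [← h1, h, h2]

end Line

/-- Given a set `F` of copies of `ℤⁿ` and a relation `att E L E'`, saying that the flat `E'` is
attached to the flat `E` along the line `L` of `E` and the parallel axis of `E'`, this is the edge
relation of the resulting graph with vertex set `F × ℤⁿ`. -/
inductive flatRel {n : ℕ} {F : Type*} (att : F → Line n → F → Prop) :
    F × (Fin n → ℤ) → F × (Fin n → ℤ) → Prop
  | inc (E : F) (x : Fin n → ℤ) (j : Fin n) : flatRel att (E, x) (E, x + Pi.single j 1)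
  | cross (E : F) (L : Line n) (E' : F) (t : ℤ) (h : att E L E') :
      flatRel att (E, L.at' t) (E', (Line.zero L.axis).at' t)

section FlatRel

variable {n : ℕ} {F : Type*} {att : F → Line n → F → Prop}

theorem near_add_single (att : F → Line n → F → Prop) (E : F) (x : Fin n → ℤ) (j : Fin n)
    (s : ℕ) : Near (flatRel att) s (E, x) (E, x + Pi.single j (s : ℤ)) := by
  induction s with
  | zero => simp [Near]
  | succ s ih =>
    have h := ih.trans (Near.of_rel (flatRel.inc (att := att) E (x + Pi.single j (s : ℤ)) j))
    rwa [add_assoc, ← Pi.single_add] at h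

theorem near_cross {E E' : F} {L : Line n} (h : att E L E') (t : ℤ) :
    Near (flatRel att) 1 (E, L.at' t) (E', (Line.zero L.axis).at' t) :=
  Near.of_rel (flatRel.cross E L E' t h)

variable [Nontrivial (Fin n)]

theorem near_ray (att : F → Line n → F → Prop) (E : F) (i : Fin n) (a s : ℕ) (t : ℤ) :
    Near (flatRel att) s (E, (Line.ray i a).at' t) (E, (Line.ray i (a + s)).at' t) := by
  have h := near_add_single att E ((Line.ray i a).at' t) (Line.other i) s
  rwa [Line.ray_at, add_assoc, ← Pi.single_add, ← Nat.cast_add, ← Line.ray_at, ← Line.ray_at] at h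

theorem near_ray_zero (att : F → Line n → F → Prop) (E : F) (i : Fin n) (s : ℕ) (t : ℤ) :
    Near (flatRel att) s (E, (Line.zero i).at' t) (E, (Line.ray i s).at' t) := by
  have h := near_ray att E i 0 s t
  rwa [zero_add, Line.ray_zero] at h

theorem near_shift (att : F → Line n → F → Prop) (N : ℕ) (E : F) (L : Line n) (t : ℤ) :
    Near (flatRel att) (N + 1) (E, L.at' t) (E, (L.shift N).at' t) := by
  rcases L.shift_cases N with ⟨s, hs, h⟩ | ⟨-, h⟩
  · rw [h]
    conv in L.at' t => rw [hs]
    exact near_ray att E L.axis s (N + 1) t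
  · rw [h]
    exact Near.refl _ _ _

end FlatRel

/-- Local data for a tree of copies of `ℤⁿ`: a flat has a type in `T`, and a move `m` leads from
a flat of type `src m`, across a line in direction `axis m`, to a flat of type `tgt m`. -/
structure MoveSys (n : ℕ) (T M : Type) where
  src : M → T
  tgt : M → T
  axis : M → Fin n
  inv : M → M
  inv_inv : ∀ m, inv (inv m) = m
  src_inv : ∀ m, src (inv m) = tgt m
  axis_inv : ∀ m, axis (inv m) = axis m
  root : T
  exists_move : ∀ t i, ∃ m, src m = t ∧ axis m = i

namespace MoveSys

variable {n : ℕ} {T M : Type} (S : MoveSys n T M)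

theorem tgt_inv (m : M) : S.tgt (S.inv m) = S.src m := by
  rw [← S.src_inv, S.inv_inv]

/-- The type of the flat reached by a sequence of moves, the last move coming first. -/
def ty : List (M × (Fin n → ℤ)) → T
  | [] => S.root
  | a :: _ => S.tgt a.1

/-- Crossing the line through `ℓ` by the move `m` undoes the last step of the sequence. -/
def Backtracks (m : M) (ℓ : Fin n → ℤ) : List (M × (Fin n → ℤ)) → Prop
  | [] => False
  | a :: _ => m = S.inv a.1 ∧ ℓ = 0

/-- A sequence of moves is reduced if it starts at the root type and never backtracks. -/
def Red : List (M × (Fin n → ℤ)) → Prop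
  | [] => True
  | a :: E => Red E ∧ S.src a.1 = S.ty E ∧ a.2 (S.axis a.1) = 0 ∧ ¬ S.Backtracks a.1 a.2 E

/-- The flats of the tree of flats described by `S`. -/
def Flat : Type := {E : List (M × (Fin n → ℤ)) // S.Red E}

/-- The tree structure on the set of flats. -/
def att (E : S.Flat) (L : Line n) (E' : S.Flat) : Prop :=
  ∃ m, S.axis m = L.axis ∧ E'.1 = (m, L.pt) :: E.1

/-- A chosen child of a flat along a line other than the coordinate axes. -/
def child (E : S.Flat) (L : Line n) (hL : L.pt ≠ 0) : S.Flat :=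
  ⟨((S.exists_move (S.ty E.1) L.axis).choose, L.pt) :: E.1, E.2,
    (S.exists_move (S.ty E.1) L.axis).choose_spec.1, by
      rw [(S.exists_move (S.ty E.1) L.axis).choose_spec.2]; exact L.pt_axis, by
      cases E.1 with
      | nil => exact id
      | cons a E => exact fun h => hL h.2⟩

variable {S}

theorem child_att (E : S.Flat) (L : Line n) (hL : L.pt ≠ 0) : S.att E L (S.child E L hL) :=
  ⟨_, (S.exists_move (S.ty E.1) L.axis).choose_spec.2, rfl⟩

theorem att_unique {E₁ E₂ E' : S.Flat} {L₁ L₂ : Line n} (h₁ : S.att E₁ L₁ E')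
    (h₂ : S.att E₂ L₂ E') : E₁ = E₂ ∧ L₁ = L₂ := by
  obtain ⟨m₁, ha₁, he₁⟩ := h₁
  obtain ⟨m₂, ha₂, he₂⟩ := h₂
  rw [he₁, List.cons.injEq, Prod.mk.injEq] at he₂
  obtain ⟨⟨hm, hp⟩, he⟩ := he₂
  exact ⟨Subtype.ext he, Line.ext (by rw [← ha₁, ← ha₂, hm]) hp⟩

theorem exists_att (E' : S.Flat) (h : E'.1 ≠ []) : ∃ E L, S.att E L E' := by
  obtain ⟨_ | ⟨a, E⟩, hE⟩ := E'
  · exact absurd rfl h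
  · exact ⟨⟨E, hE.1⟩, ⟨S.axis a.1, a.2, hE.2.2.1⟩, a.1, rfl, rfl⟩

theorem att_length {E E' : S.Flat} {L : Line n} (h : S.att E L E') :
    E'.1.length = E.1.length + 1 := by
  obtain ⟨m, -, he⟩ := h
  simp [he]

theorem att_ne_nil {E E' : S.Flat} {L : Line n} (h : S.att E L E') : E'.1 ≠ [] := by
  obtain ⟨m, -, he⟩ := h
  simp [he]

variable [Nontrivial (Fin n)]

theorem pt_ne_zero {L : Line n} (hL : L ≠ Line.ray L.axis 0) : L.pt ≠ 0 := by
  intro h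
  refine hL (Line.ext rfl ?_)
  rw [Line.ray_zero, h]
  rfl

theorem ray_pt_ne_zero (i : Fin n) (s : ℕ) : (Line.ray i (s + 1)).pt ≠ 0 :=
  pt_ne_zero fun h => absurd (Line.ray_injective h) (Nat.succ_ne_zero s)

variable (S) in
/-- The child of `E` reserved for the line `L`. -/
def reserved (N : ℕ) (E : S.Flat) (L : Line n) : S.Flat :=
  S.child E (L.shift N) (pt_ne_zero (L.shift_ne_ray N _ (Nat.zero_le N)))

variable (S) in
/-- Grandchildren of `E` which can be reattached to the line `L` of `E`. -/
def spare (N : ℕ) (E : S.Flat) (L : Line n) (k : Fin N) : S.Flat :=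
  S.child (S.reserved N E L) (Line.ray L.axis (k + 1)) (ray_pt_ne_zero _ _)

theorem reserved_att (N : ℕ) (E : S.Flat) (L : Line n) :
    S.att E (L.shift N) (S.reserved N E L) := child_att _ _ _

theorem spare_att (N : ℕ) (E : S.Flat) (L : Line n) (k : Fin N) :
    S.att (S.reserved N E L) (Line.ray L.axis (k + 1)) (S.spare N E L k) := child_att _ _ _

theorem reserved_inj {N : ℕ} {E₁ E₂ : S.Flat} {L₁ L₂ : Line n}
    (h : S.reserved N E₁ L₁ = S.reserved N E₂ L₂) : E₁ = E₂ ∧ L₁ = L₂ := by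
  have h₁ := reserved_att N E₁ L₁
  rw [h] at h₁
  have := att_unique h₁ (reserved_att N E₂ L₂)
  exact ⟨this.1, Line.shift_injective N this.2⟩

theorem spare_inj {N : ℕ} {E₁ E₂ : S.Flat} {L₁ L₂ : Line n} {k₁ k₂ : Fin N}
    (h : S.spare N E₁ L₁ k₁ = S.spare N E₂ L₂ k₂) : E₁ = E₂ ∧ L₁ = L₂ ∧ k₁ = k₂ := by
  have h₁ := spare_att N E₁ L₁ k₁
  rw [h] at h₁
  obtain ⟨hc, hr⟩ := att_unique h₁ (spare_att N E₂ L₂ k₂)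
  obtain ⟨rfl, rfl⟩ := reserved_inj hc
  exact ⟨rfl, rfl, Fin.ext (by have := Line.ray_injective hr; omega)⟩

theorem spare_ne_reserved {N : ℕ} {E₁ E₂ : S.Flat} {L₁ L₂ : Line n} {k : Fin N} :
    S.spare N E₁ L₁ k ≠ S.reserved N E₂ L₂ := by
  intro h
  have h₁ := spare_att N E₁ L₁ k
  rw [h] at h₁
  have h2 := (att_unique h₁ (reserved_att N E₂ L₂)).2
  exact L₂.shift_ne_ray N L₁.axis (show (k : ℕ) + 1 ≤ N by omega) h2.symm

/-- All nonroot flats can be reattached, each to a nearby line of an ancestor, such that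
every line receives exactly `N + 1` flats. -/
theorem exists_reattach (S : MoveSys n T M) {N : ℕ} (idx : M ↪ Fin N) :
    ∃ H : S.Flat × Line n × Option (Fin N) → S.Flat, Function.Injective H ∧
      (∀ E, E.1 ≠ [] → ∃ z, H z = E) ∧ (∀ E L, H (E, L, none) = S.reserved N E L) ∧
      (∀ E L k, S.att E L (H (E, L, some k)) ∨ ∃ k', H (E, L, some k) = S.spare N E L k') := by
  classical
  let O := {E : S.Flat // E.1 ≠ [] ∧ ∀ E₀ L, E ≠ S.reserved N E₀ L}
  have hf : ∀ E : O, ∃ z : S.Flat × Line n × Fin N, S.att z.1 z.2.1 E.1 ∧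
      ∀ a E', E.1.1 = a :: E' → z.2.2 = idx a.1 := by
    intro E
    obtain ⟨E₀, L, hL⟩ := exists_att E.1 E.2.1
    obtain ⟨m, hm, hE⟩ := id hL
    refine ⟨(E₀, L, idx m), hL, ?_⟩
    intro a E' h
    rw [hE, List.cons.injEq] at h
    rw [← h.1]
  choose f hfa hfi using hf
  have hfinj : Function.Injective f := by
    intro E E' h
    obtain ⟨m, hm, hE⟩ := hfa E
    obtain ⟨m', hm', hE'⟩ := hfa E'
    have hi := hfi E _ _ hE
    rw [h, hfi E' _ _ hE'] at hi
    rw [h] at hE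
    obtain rfl : m' = m := idx.injective hi
    exact Subtype.ext (Subtype.ext (hE.trans hE'.symm))
  let g : S.Flat × Line n × Fin N → O := fun z =>
    ⟨S.spare N z.1 z.2.1 z.2.2, att_ne_nil (spare_att _ _ _ _), fun _ _ => spare_ne_reserved⟩
  have hginj : Function.Injective g := by
    rintro ⟨E, L, k⟩ ⟨E', L', k'⟩ h
    obtain ⟨rfl, rfl, rfl⟩ := spare_inj (congrArg Subtype.val h)
    rfl
  obtain ⟨h, hbij, hR⟩ := Function.Embedding.schroeder_bernstein_of_rel hfinj hginj
    (fun E z => S.att z.1 z.2.1 E.1 ∨ E.1 = S.spare N z.1 z.2.1 z.2.2)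
    (fun E => Or.inl (hfa E)) (fun z => Or.inr rfl)
  let e := Equiv.ofBijective h hbij
  have he : ∀ z, h (e.symm z) = z := e.apply_symm_apply
  refine ⟨fun z => z.2.2.elim (S.reserved N z.1 z.2.1) fun k => (e.symm (z.1, z.2.1, k)).1,
    ?_, ?_, fun _ _ => rfl, ?_⟩
  · rintro ⟨E, L, _ | k⟩ ⟨E', L', _ | k'⟩ hz
    · obtain ⟨rfl, rfl⟩ := reserved_inj hz
      rfl
    · exact absurd hz.symm ((e.symm (E', L', k')).2.2 E L)
    · exact absurd hz ((e.symm (E, L, k)).2.2 E' L')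
    · have := e.symm.injective (Subtype.ext hz)
      simp only [Prod.mk.injEq] at this
      obtain ⟨rfl, rfl, rfl⟩ := this
      rfl
  · intro E hE
    by_cases hr : ∀ E₀ L, E ≠ S.reserved N E₀ L
    · refine ⟨((h ⟨E, hE, hr⟩).1, (h ⟨E, hE, hr⟩).2.1, some (h ⟨E, hE, hr⟩).2.2), ?_⟩
      exact congrArg Subtype.val (e.symm_apply_apply ⟨E, hE, hr⟩)
    · push Not at hr
      obtain ⟨E₀, L, rfl⟩ := hr
      exact ⟨(E₀, L, none), rfl⟩
  · intro E L k
    have := hR (e.symm (E, L, k))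
    rw [he] at this
    exact this.imp_right fun h => ⟨k, h⟩

end MoveSys

/-- The regular tree of flats: every line of every flat carries one flat for each `o : O`. -/
def regularAtt (n : ℕ) (O : Type) (l : List (Line n × O)) (L : Line n) (l' : List (Line n × O)) :
    Prop :=
  ∃ o, l' = (L, o) :: l

/-- Every tree of flats described by a finite system of moves is coarsely equivalent to a
regular tree of flats. -/
theorem MoveSys.coarseEquiv_regular {n : ℕ} [Nontrivial (Fin n)] {T M : Type} (S : MoveSys n T M)
    {N : ℕ} (idx : M ↪ Fin N) :
    CoarseEquiv (flatRel S.att) (flatRel (regularAtt n (Option (Fin N)))) := by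
  obtain ⟨H, hinj, hsurj, hnone, hsome⟩ := S.exists_reattach idx
  have hlen : ∀ E L o, E.1.length < (H (E, L, o)).1.length := by
    rintro E L (_ | k)
    · rw [hnone, att_length (reserved_att N E L)]
      omega
    · rcases hsome E L k with h | ⟨k', h⟩
      · rw [att_length h]
        omega
      · rw [h, att_length (spare_att N E L k'), att_length (reserved_att N E L)]
        omega
  let Φ : List (Line n × Option (Fin N)) → S.Flat := fun l =>
    l.foldr (fun a E => H (E, a.1, a.2)) ⟨[], trivial⟩
  have hcons : ∀ L o l, Φ ((L, o) :: l) = H (Φ l, L, o) := fun _ _ _ => rfl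
  have hne : ∀ a l, Φ (a :: l) ≠ Φ [] := by
    intro a l h
    have := hlen (Φ l) a.1 a.2
    rw [← hcons, show ((a.1, a.2) : Line n × Option (Fin N)) = a from rfl, h] at this
    exact absurd this (Nat.not_lt_zero _)
  have hΦi : Function.Injective Φ := by
    intro l
    induction l with
    | nil =>
      rintro (_ | ⟨a, l'⟩) h
      · rfl
      · exact absurd h.symm (hne a l')
    | cons a l ih =>
      rintro (_ | ⟨b, l'⟩) h
      · exact absurd h (hne a l)
      · have := hinj h
        simp only [Prod.mk.injEq] at this
        obtain ⟨h1, h2, h3⟩ := this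
        rw [ih h1, Prod.ext h2 h3]
  have hΦs : ∀ k, ∀ E : S.Flat, E.1.length ≤ k → ∃ l, Φ l = E := by
    intro k
    induction k with
    | zero =>
      intro E hE
      exact ⟨[], Subtype.ext (List.length_eq_zero_iff.1 (Nat.le_zero.1 hE)).symm⟩
    | succ k ih =>
      intro E hE
      by_cases h0 : E.1 = []
      · exact ⟨[], Subtype.ext h0.symm⟩
      · obtain ⟨⟨E₀, L, o⟩, rfl⟩ := hsurj E h0
        obtain ⟨l, rfl⟩ := ih E₀ (by have := hlen E₀ L o; omega)
        exact ⟨(L, o) :: l, rfl⟩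
  let e := Equiv.ofBijective Φ ⟨hΦi, fun E => hΦs _ E le_rfl⟩
  have he : ∀ l, Φ l = e l := fun _ => rfl
  have hatt : ∀ E L o, regularAtt n (Option (Fin N)) (e.symm E) L (e.symm (H (E, L, o))) := by
    intro E L o
    refine ⟨o, e.injective ?_⟩
    rw [e.apply_symm_apply, ← he, hcons, he, e.apply_symm_apply]
  refine ⟨fun p => (e.symm p.1, p.2), fun p => (e p.1, p.2), 2 * N + 5, ?_, ?_, ?_, ?_⟩
  · rintro _ _ (⟨E, x, j⟩ | ⟨E, L, E', t, h⟩)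
    · exact (Near.of_rel (flatRel.inc _ _ _)).mono (by omega)
    · obtain ⟨⟨E₀, L₀, _ | k⟩, rfl⟩ := hsurj E' (att_ne_nil h)
      · have ha := hatt E₀ L₀ none
        rw [hnone] at h ha ⊢
        obtain ⟨rfl, rfl⟩ := att_unique h (reserved_att N E₀ L₀)
        have h1 := near_shift (regularAtt n (Option (Fin N))) N (e.symm E) L₀ t
        have h2 := near_cross ha t
        rw [Line.shift_axis]
        exact (h1.symm.trans h2).mono (by omega)
      · have ha := hatt E₀ L₀ (some k)
        rcases hsome E₀ L₀ k with h' | ⟨k', h'⟩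
        · obtain ⟨rfl, rfl⟩ := att_unique h h'
          exact (near_cross ha t).mono (by omega)
        · rw [h'] at h
          obtain ⟨rfl, rfl⟩ := att_unique h (spare_att N E₀ L₀ k')
          have hb := hatt E₀ L₀ none
          rw [hnone] at hb
          have h1 := near_ray_zero (regularAtt n (Option (Fin N)))
            (e.symm (S.reserved N E₀ L₀)) L₀.axis (k' + 1) t
          exact ((h1.symm.trans (near_cross hb t).symm).trans (near_cross ha t)).mono (by omega)
  · rintro _ _ (⟨l, x, j⟩ | ⟨l, L, _, t, ⟨o, rfl⟩⟩)
    · exact (Near.of_rel (flatRel.inc _ _ _)).mono (by omega)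
    · have hres : Near (flatRel S.att) (N + 1 + 1) (Φ l, L.at' t)
          (S.reserved N (Φ l) L, (Line.zero L.axis).at' t) := by
        have h1 := near_cross (reserved_att N (Φ l) L) t
        rw [Line.shift_axis] at h1
        exact (near_shift S.att N (Φ l) L t).trans h1
      simp only [← he]
      rw [hcons]
      rcases o with _ | k
      · rw [hnone]
        exact hres.mono (by omega)
      · rcases hsome (Φ l) L k with h' | ⟨k', h'⟩
        · exact (near_cross h' t).mono (by omega)
        · rw [h']
          have h1 := near_ray_zero S.att (S.reserved N (Φ l) L) L.axis (k' + 1) t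
          have h2 := near_cross (spare_att N (Φ l) L k') t
          exact ((hres.trans h1).trans h2).mono (by omega)
  · intro p
    simp only [e.apply_symm_apply]
    exact Near.refl _ _ _
  · intro p
    simp only [e.symm_apply_apply]
    exact Near.refl _ _ _

namespace MoveSys

variable {n : ℕ} {T M : Type} (S : MoveSys n T M)

open Classical in
/-- Crossing the line in direction `axis m` through a point by the move `m`. -/
def crossFun (m : M) : List (M × (Fin n → ℤ)) × (Fin n → ℤ) → List (M × (Fin n → ℤ)) × (Fin n → ℤ)
  | ([], x) => ([(m, Function.update x (S.axis m) 0)], Pi.single (S.axis m) (x (S.axis m)))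
  | (a :: E, x) =>
    if m = S.inv a.1 ∧ Function.update x (S.axis m) 0 = 0 then
      (E, Function.update a.2 (S.axis m) (x (S.axis m)))
    else ((m, Function.update x (S.axis m) 0) :: a :: E, Pi.single (S.axis m) (x (S.axis m)))

theorem crossFun_of_not_backtracks {m : M} {E : List (M × (Fin n → ℤ))} {x : Fin n → ℤ}
    (h : ¬ S.Backtracks m (Function.update x (S.axis m) 0) E) :
    S.crossFun m (E, x) =
      ((m, Function.update x (S.axis m) 0) :: E, Pi.single (S.axis m) (x (S.axis m))) := by
  cases E with
  | nil => rfl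
  | cons a E => exact if_neg h

theorem crossFun_cons (a : M × (Fin n → ℤ)) (E : List (M × (Fin n → ℤ))) (t : ℤ) :
    S.crossFun (S.inv a.1) (a :: E, Pi.single (S.axis a.1) t) =
      (E, Function.update a.2 (S.axis a.1) t) := by
  have h : Function.update (Pi.single (S.axis a.1) t : Fin n → ℤ) (S.axis a.1) 0 = 0 := by
    simp [Pi.single]
  simp [crossFun, S.axis_inv, h]

theorem crossFun_cases (m : M) (E : List (M × (Fin n → ℤ))) (x : Fin n → ℤ) :
    ¬ S.Backtracks m (Function.update x (S.axis m) 0) E ∨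
      ∃ a E' t, E = a :: E' ∧ m = S.inv a.1 ∧ x = Pi.single (S.axis a.1) t := by
  cases E with
  | nil => exact Or.inl id
  | cons a E =>
    refine Classical.or_iff_not_imp_left.2 fun h => ?_
    obtain ⟨rfl, h⟩ := not_not.1 h
    rw [S.axis_inv] at h
    refine ⟨a, E, x (S.axis a.1), rfl, rfl, ?_⟩
    rw [Pi.single, ← h, Function.update_idem, Function.update_eq_self]

/-- The points of the flats of type `t`. -/
def Pt (t : T) : Type :=
  {p : List (M × (Fin n → ℤ)) × (Fin n → ℤ) // S.Red p.1 ∧ S.ty p.1 = t}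

variable {S}

theorem crossFun_mem (m : M) (p : S.Pt (S.src m)) :
    S.Red (S.crossFun m p.1).1 ∧ S.ty (S.crossFun m p.1).1 = S.tgt m := by
  obtain ⟨⟨E, x⟩, hE, ht⟩ := p
  rcases S.crossFun_cases m E x with h | ⟨a, E', t, rfl, rfl, rfl⟩
  · dsimp only
    rw [S.crossFun_of_not_backtracks h]
    exact ⟨⟨hE, ht.symm, Function.update_self _ _ _, h⟩, rfl⟩
  · dsimp only
    rw [S.crossFun_cons]
    exact ⟨hE.1, by rw [S.tgt_inv]; exact hE.2.1.symm⟩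

theorem crossFun_inv_crossFun (m : M) {E : List (M × (Fin n → ℤ))} (x : Fin n → ℤ)
    (hE : S.Red E) : S.crossFun (S.inv m) (S.crossFun m (E, x)) = (E, x) := by
  rcases S.crossFun_cases m E x with h | ⟨a, E', t, rfl, rfl, rfl⟩
  · rw [S.crossFun_of_not_backtracks h]
    have := S.crossFun_cons (m, Function.update x (S.axis m) 0) E (x (S.axis m))
    rw [this, Function.update_idem, Function.update_eq_self]
  · have h0 : Function.update (Function.update a.2 (S.axis a.1) t) (S.axis a.1) 0 = a.2 := by
      rw [Function.update_idem, ← hE.2.2.1, Function.update_eq_self]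
    rw [S.crossFun_cons, S.inv_inv, S.crossFun_of_not_backtracks (by rw [h0]; exact hE.2.2.2), h0,
      Function.update_self]

/-- The bijection between points of flats of the source type and of the target type of a move. -/
def crossEquiv (m : M) : S.Pt (S.src m) ≃ S.Pt (S.tgt m) where
  toFun p := ⟨S.crossFun m p.1, crossFun_mem m p⟩
  invFun p := ⟨S.crossFun (S.inv m) p.1, by
    have := crossFun_mem (S.inv m) ⟨p.1, p.2.1, by rw [S.src_inv]; exact p.2.2⟩
    rwa [S.tgt_inv] at this⟩
  left_inv p := Subtype.ext (crossFun_inv_crossFun m _ p.2.1)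
  right_inv p := Subtype.ext (by
    have := crossFun_inv_crossFun (S.inv m) p.1.2 p.2.1
    rwa [S.inv_inv] at this)

/-- Translation of all flats of a given type in a coordinate direction. -/
def incEquiv (t : T) (i : Fin n) : Equiv.Perm (S.Pt t) where
  toFun p := ⟨(p.1.1, p.1.2 + Pi.single i 1), p.2⟩
  invFun p := ⟨(p.1.1, p.1.2 - Pi.single i 1), p.2⟩
  left_inv _ := Subtype.ext (Prod.ext rfl (add_sub_cancel_right _ _))
  right_inv _ := Subtype.ext (Prod.ext rfl (sub_add_cancel _ _))

theorem incEquiv_comm (t : T) (i j : Fin n) (p : S.Pt t) :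
    incEquiv t i (incEquiv t j p) = incEquiv t j (incEquiv t i p) :=
  Subtype.ext (Prod.ext rfl (add_right_comm _ _ _))

theorem crossEquiv_incEquiv (m : M) (p : S.Pt (S.src m)) :
    crossEquiv m (incEquiv _ (S.axis m) p) = incEquiv _ (S.axis m) (crossEquiv m p) := by
  obtain ⟨⟨E, x⟩, hE, ht⟩ := p
  refine Subtype.ext ?_
  change S.crossFun m (E, x + Pi.single (S.axis m) 1) =
    ((S.crossFun m (E, x)).1, (S.crossFun m (E, x)).2 + Pi.single (S.axis m) 1)
  rcases S.crossFun_cases m E x with h | ⟨a, E', t, rfl, rfl, rfl⟩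
  · have h0 : Function.update (x + Pi.single (S.axis m) 1) (S.axis m) 0 =
        Function.update x (S.axis m) 0 := by
      ext j
      by_cases hj : j = S.axis m
      · subst hj; simp
      · simp [hj]
    rw [S.crossFun_of_not_backtracks h, S.crossFun_of_not_backtracks (by rwa [h0]), h0]
    simp [Pi.single_add]
  · rw [S.axis_inv, ← Pi.single_add, S.crossFun_cons, S.crossFun_cons]
    refine Prod.ext rfl ?_
    ext j
    by_cases hj : j = S.axis a.1
    · subst hj; simp
    · simp [hj]

/-- A point, as a vertex of the tree of flats. -/
def Pt.out {t : T} (p : S.Pt t) : S.Flat × (Fin n → ℤ) := (⟨p.1.1, p.2.1⟩, p.1.2)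

theorem near_incEquiv {t : T} (i : Fin n) (p : S.Pt t) :
    Near (flatRel S.att) 1 p.out (incEquiv t i p).out :=
  Near.of_rel (flatRel.inc _ _ _)

theorem near_crossEquiv (m : M) (p : S.Pt (S.src m)) :
    Near (flatRel S.att) 1 p.out (crossEquiv m p).out := by
  have key : ∀ (a : M × (Fin n → ℤ)) (E : List (M × (Fin n → ℤ))) (h : S.Red E)
      (h' : S.Red (a :: E)) (t : ℤ), Near (flatRel S.att) 1
        (⟨E, h⟩, Function.update a.2 (S.axis a.1) t) (⟨a :: E, h'⟩, Pi.single (S.axis a.1) t) :=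
    fun a E h h' t => near_cross (att := S.att) (E := ⟨E, h⟩) (E' := ⟨a :: E, h'⟩)
      (L := ⟨S.axis a.1, a.2, h'.2.2.1⟩) ⟨a.1, rfl, rfl⟩ t
  obtain ⟨⟨E, x⟩, hE, ht⟩ := p
  rcases S.crossFun_cases m E x with h | ⟨a, E', t, rfl, rfl, rfl⟩
  · have h1 := S.crossFun_of_not_backtracks h
    have hR : S.Red ((m, Function.update x (S.axis m) 0) :: E) :=
      ⟨hE, ht.symm, Function.update_self _ _ _, h⟩
    have h2 := key _ E hE hR (x (S.axis m))
    rw [Function.update_idem, Function.update_eq_self] at h2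
    have h3 : (crossEquiv m ⟨(E, x), hE, ht⟩).out = (⟨_ :: E, hR⟩, _) :=
      Prod.ext (Subtype.ext (congrArg Prod.fst h1)) (show (S.crossFun m (E, x)).2 = _ by rw [h1])
    rw [h3]
    exact h2
  · have h1 := S.crossFun_cons a E' t
    have h3 : (crossEquiv (S.inv a.1) ⟨(a :: E', _), hE, ht⟩).out = (⟨E', hE.1⟩, _) :=
      Prod.ext (Subtype.ext (congrArg Prod.fst h1))
        (show (S.crossFun (S.inv a.1) (a :: E', _)).2 = _ by rw [h1])
    rw [h3]
    exact (key a E' hE.1 hE t).symm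

theorem crossEquiv_cons (a : M × (Fin n → ℤ)) (E : List (M × (Fin n → ℤ))) (h : S.Red (a :: E)) :
    crossEquiv a.1 ⟨(E, a.2), h.1, h.2.1.symm⟩ = ⟨(a :: E, 0), h, rfl⟩ := by
  have h0 : Function.update a.2 (S.axis a.1) 0 = a.2 := by
    rw [← h.2.2.1, Function.update_eq_self]
  refine Subtype.ext ?_
  change S.crossFun a.1 (E, a.2) = (a :: E, 0)
  rw [S.crossFun_of_not_backtracks (by rw [h0]; exact h.2.2.2), h0, h.2.2.1, Pi.single_zero]

/-- A property of points which is invariant under translations and crossings and which holds for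
the base point holds everywhere. -/
theorem Pt.induction {Q : ∀ t, S.Pt t → Prop} (h0 : Q S.root ⟨([], 0), trivial, rfl⟩)
    (hinc : ∀ t i p, Q t p ↔ Q t (incEquiv t i p))
    (hcross : ∀ m p, Q (S.src m) p → Q (S.tgt m) (crossEquiv m p)) (t : T) (p : S.Pt t) :
    Q t p := by
  have htrans : ∀ (t : T) (E : List (M × (Fin n → ℤ))) (h : S.Red E ∧ S.ty E = t)
      (y : Fin n → ℤ), Q t ⟨(E, 0), h⟩ → Q t ⟨(E, y), h⟩ := by
    intro t E h y h0
    let H : AddSubgroup (Fin n → ℤ) :=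
      { carrier := {y | ∀ x, Q t ⟨(E, x), h⟩ ↔ Q t ⟨(E, x + y), h⟩}
        zero_mem' := fun x => by simp
        add_mem' := fun {a b} ha hb x => by rw [ha x, hb (x + a), add_assoc]
        neg_mem' := fun {a} ha x => by rw [ha (x + -a), neg_add_cancel_right] }
    have hy : y ∈ H := by
      refine AddSubgroup.pi_mem_of_single_mem y fun i => ?_
      have h1 : Pi.single i 1 ∈ H := fun x => hinc t i ⟨(E, x), h⟩
      have h2 := H.zsmul_mem h1 (y i)
      rwa [← Pi.single_smul, smul_eq_mul, mul_one] at h2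
    have := (hy 0).1 h0
    rwa [zero_add] at this
  obtain ⟨⟨E, x⟩, hE, rfl⟩ := p
  induction E generalizing x with
  | nil => exact htrans _ _ _ _ h0
  | cons a E ih =>
    refine htrans _ _ _ _ ?_
    have h1 := ih a.2 hE.1
    obtain ⟨m, ℓ⟩ := a
    have h2 : ∀ (t : T) (ht : t = S.src m) (hp : S.Red E ∧ S.ty E = t), Q t ⟨(E, ℓ), hp⟩ →
        Q (S.tgt m) ⟨((m, ℓ) :: E, 0), hE, rfl⟩ := by
      rintro _ rfl hp hq
      have h3 := hcross m _ hq
      rwa [crossEquiv_cons (m, ℓ) E hE] at h3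
    exact h2 _ hE.2.1.symm _ h1

end MoveSys

/-- A realisation of a tree of flats in a group: flats of type `t` are modelled on left cosets of
an abelian subgroup with basis `gen t`, and moves are right multiplications. -/
structure MoveSys.Model {n : ℕ} {T M : Type} (S : MoveSys n T M) (G : Type) [Group G] where
  gen : T → Fin n → G
  elt : M → G
  comm : ∀ t i j, Commute (gen t i) (gen t j)
  elt_inv : ∀ m, elt (S.inv m) = (elt m)⁻¹
  gen_elt : ∀ m, gen (S.src m) (S.axis m) * elt m = elt m * gen (S.tgt m) (S.axis m)

namespace MoveSys.Model

variable {n : ℕ} {T M : Type} {S : MoveSys n T M} {G : Type} [Group G] (R : S.Model G)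

theorem pairwise_comm (t : T) : Pairwise fun i j => ∀ a b : Multiplicative ℤ,
    Commute (zpowersHom G (R.gen t i) a) (zpowersHom G (R.gen t j) b) :=
  fun i j _ _ _ => (R.comm t i j).zpow_zpow _ _

/-- The homomorphism `ℤⁿ → G` sending the standard basis to `gen t`. -/
def vec (t : T) (x : Fin n → ℤ) : G :=
  MonoidHom.noncommPiCoprod (fun i => zpowersHom G (R.gen t i))
    (R.pairwise_comm t)
    (fun i => Multiplicative.ofAdd (x i))

theorem vec_add (t : T) (x y : Fin n → ℤ) : R.vec t (x + y) = R.vec t x * R.vec t y :=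
  map_mul (MonoidHom.noncommPiCoprod _ _) _ _

theorem vec_single (t : T) (i : Fin n) (k : ℤ) : R.vec t (Pi.single i k) = R.gen t i ^ k := by
  have h : (fun j => Multiplicative.ofAdd ((Pi.single i k : Fin n → ℤ) j)) =
      Pi.mulSingle i (Multiplicative.ofAdd k) := by
    ext j
    by_cases hj : j = i
    · subst hj; simp
    · simp [hj]
  rw [vec, h, MonoidHom.noncommPiCoprod_mulSingle, zpowersHom_apply]
  rfl

theorem vec_zero (t : T) : R.vec t 0 = 1 :=
  map_one (MonoidHom.noncommPiCoprod _ _)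

/-- The group element at the origin of a flat. -/
def evFlat : List (M × (Fin n → ℤ)) → G
  | [] => 1
  | a :: E => evFlat E * R.vec (S.src a.1) a.2 * R.elt a.1

/-- The group element at a point of a flat. -/
def ev (p : List (M × (Fin n → ℤ)) × (Fin n → ℤ)) : G := R.evFlat p.1 * R.vec (S.ty p.1) p.2

theorem ev_base : R.ev ([], 0) = 1 := by
  simp [ev, evFlat, vec_zero]

theorem ev_add_single (E : List (M × (Fin n → ℤ))) (x : Fin n → ℤ) (i : Fin n) :
    R.ev (E, x + Pi.single i 1) = R.ev (E, x) * R.gen (S.ty E) i := by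
  simp [ev, vec_add, vec_single, mul_assoc]

theorem ev_cons {a : M × (Fin n → ℤ)} {E : List (M × (Fin n → ℤ))} (h : S.Red (a :: E)) (t : ℤ) :
    R.ev (a :: E, Pi.single (S.axis a.1) t) =
      R.ev (E, Function.update a.2 (S.axis a.1) t) * R.elt a.1 := by
  have h1 : Function.update a.2 (S.axis a.1) t = a.2 + Pi.single (S.axis a.1) t := by
    ext j
    by_cases hj : j = S.axis a.1
    · subst hj; simp [h.2.2.1]
    · simp [hj]
  have h2 : R.elt a.1 * R.gen (S.tgt a.1) (S.axis a.1) ^ t =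
      R.gen (S.src a.1) (S.axis a.1) ^ t * R.elt a.1 :=
    (SemiconjBy.zpow_right (show SemiconjBy _ _ _ from (R.gen_elt a.1).symm) t)
  rw [h1]
  simp only [ev, evFlat, vec_add, vec_single, ← h.2.1, mul_assoc]
  rw [← h2]
  rfl

theorem ev_incEquiv {t : T} (i : Fin n) (p : S.Pt t) :
    R.ev (incEquiv t i p).1 = R.ev p.1 * R.gen t i := by
  obtain ⟨⟨E, x⟩, hE, rfl⟩ := p
  exact R.ev_add_single E x i

theorem ev_crossEquiv (m : M) (p : S.Pt (S.src m)) :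
    R.ev (crossEquiv m p).1 = R.ev p.1 * R.elt m := by
  obtain ⟨⟨E, x⟩, hE, ht⟩ := p
  change R.ev (S.crossFun m (E, x)) = R.ev (E, x) * R.elt m
  rcases S.crossFun_cases m E x with h | ⟨a, E', t, rfl, rfl, rfl⟩
  · have h1 := R.ev_cons (a := (m, Function.update x (S.axis m) 0)) (E := E)
      ⟨hE, ht.symm, Function.update_self _ _ _, h⟩ (x (S.axis m))
    rw [Function.update_idem, Function.update_eq_self] at h1
    rw [S.crossFun_of_not_backtracks h, h1]
  · rw [S.crossFun_cons, R.ev_cons hE, R.elt_inv, mul_inv_cancel_right]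

end MoveSys.Model

/-- Combinatorial data describing a graph as a rooted tree of `n`-cliques, with some further
valence one vertices attached. The `n`-cliques are indexed by `B`, the vertices of the clique `b`
are `vert b i` for a proper colouring `col` of the graph, and every clique other than the root
is attached to its parent along its vertex of colour `acol`. -/
structure CliqueTree {V : Type} (Γ : SimpleGraph V) (n : ℕ) where
  B : Type
  finite : Finite B
  root : B
  par : B → B
  rank : B → ℕ
  rank_par : ∀ b, b ≠ root → rank (par b) < rank b
  vert : B → Fin n → V
  col : V → Fin n
  acol : B → Fin n
  home : V → B
  leaf : V → Prop
  sup : V → V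
  adj_vert : ∀ b i j, i ≠ j → Γ.Adj (vert b i) (vert b j)
  col_vert : ∀ b i, col (vert b i) = i
  not_leaf_vert : ∀ b i, ¬ leaf (vert b i)
  home_vert : ∀ b i, home (vert b i) = b ∨ (b ≠ root ∧ i = acol b)
  vert_acol : ∀ b, b ≠ root → vert b (acol b) = vert (par b) (acol b)
  home_acol : ∀ b, b ≠ root → home (vert b (acol b)) = par b
  vert_home : ∀ v, ¬ leaf v → vert (home v) (col v) = v
  not_leaf_sup : ∀ u, leaf u → ¬ leaf (sup u)
  adj_sup : ∀ u, leaf u → Γ.Adj u (sup u)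
  adj_cases : ∀ v w, Γ.Adj v w →
    (∃ b i j, v = vert b i ∧ w = vert b j) ∨ (leaf v ∧ w = sup v) ∨ (leaf w ∧ v = sup w)
  exists_child : ∀ b i, home (vert b i) = b →
    (∃ b', b' ≠ root ∧ par b' = b ∧ acol b' = i) ∨ ∃ u, leaf u ∧ sup u = vert b i

theorem commute_raagGen {V : Type} {Γ : SimpleGraph V} {v w : V} (h : Γ.Adj v w) :
    Commute (raagGen Γ v) (raagGen Γ w) := by
  have h1 := PresentedGroup.one_of_mem (rels := raagRels Γ) ⟨v, w, h, rfl⟩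
  have h2 : raagGen Γ v * raagGen Γ w * (raagGen Γ v)⁻¹ * (raagGen Γ w)⁻¹ = 1 := h1
  rw [mul_inv_eq_one, mul_inv_eq_iff_eq_mul] at h2
  exact h2

namespace CliqueTree

variable {V : Type} {Γ : SimpleGraph V} {n : ℕ} (Θ : CliqueTree Γ n)

/-- The moves between cosets of the `n`-clique subgroups: passing to the parent or to a child, or
multiplying with a generator of valence one or its inverse. -/
abbrev Move : Type := ({b // b ≠ Θ.root} ⊕ {u // Θ.leaf u}) × Bool

/-- The tree of flats of the clique tree. -/
def sys : MoveSys n Θ.B Θ.Move where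
  src
    | (Sum.inl b, true) => b.1
    | (Sum.inl b, false) => Θ.par b
    | (Sum.inr u, _) => Θ.home (Θ.sup u)
  tgt
    | (Sum.inl b, true) => Θ.par b
    | (Sum.inl b, false) => b.1
    | (Sum.inr u, _) => Θ.home (Θ.sup u)
  axis
    | (Sum.inl b, _) => Θ.acol b
    | (Sum.inr u, _) => Θ.col (Θ.sup u)
  inv m := (m.1, !m.2)
  inv_inv := by rintro ⟨x, _ | _⟩ <;> rfl
  src_inv := by rintro ⟨x | x, _ | _⟩ <;> rfl
  axis_inv := by rintro ⟨x | x, _ | _⟩ <;> rfl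
  root := Θ.root
  exists_move := by
    intro b i
    rcases Θ.home_vert b i with h | ⟨h, rfl⟩
    · rcases Θ.exists_child b i h with ⟨b', h1, h2, h3⟩ | ⟨u, h1, h2⟩
      · exact ⟨(Sum.inl ⟨b', h1⟩, false), h2, h3⟩
      · refine ⟨(Sum.inr ⟨u, h1⟩, true), ?_, ?_⟩
        · change Θ.home (Θ.sup u) = b
          rw [h2, h]
        · change Θ.col (Θ.sup u) = i
          rw [h2, Θ.col_vert]
    · exact ⟨(Sum.inl ⟨b, h⟩, true), rfl, rfl⟩

/-- The realisation of the tree of flats in the right-angled Artin group. -/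
def model : Θ.sys.Model (Raag Γ) where
  gen b i := raagGen Γ (Θ.vert b i)
  elt
    | (Sum.inl _, _) => 1
    | (Sum.inr u, true) => raagGen Γ u.1
    | (Sum.inr u, false) => (raagGen Γ u.1)⁻¹
  comm b i j := by
    by_cases h : i = j
    · rw [h]
    · exact commute_raagGen (Θ.adj_vert b i j h)
  elt_inv := by
    rintro ⟨x | x, _ | _⟩
    · exact inv_one.symm
    · exact inv_one.symm
    · exact (inv_inv _).symm
    · rfl
  gen_elt := by
    rintro ⟨b | u, s⟩
    · have h : raagGen Γ (Θ.vert b.1 (Θ.acol b)) = raagGen Γ (Θ.vert (Θ.par b) (Θ.acol b)) := by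
        rw [Θ.vert_acol b.1 b.2]
      cases s
      · exact ((mul_one _).trans h.symm).trans (one_mul _).symm
      · exact ((mul_one _).trans h).trans (one_mul _).symm
    · have h : Commute (raagGen Γ (Θ.vert (Θ.home (Θ.sup u)) (Θ.col (Θ.sup u))))
          (raagGen Γ u.1) := by
        rw [Θ.vert_home _ (Θ.not_leaf_sup u.1 u.2)]
        exact (commute_raagGen (Θ.adj_sup u.1 u.2)).symm
      cases s
      · exact h.inv_right
      · exact h

theorem elt_inl (b : {b // b ≠ Θ.root}) (s : Bool) : Θ.model.elt (Sum.inl b, s) = 1 := rfl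

theorem gen_model (b : Θ.B) (i : Fin n) : Θ.model.gen b i = raagGen Γ (Θ.vert b i) := rfl

/-- Passing from a point of a flat of type `b` to the corresponding point of the adjacent flat of
the parent type. -/
def up {b : Θ.B} (h : b ≠ Θ.root) : Θ.sys.Pt b ≃ Θ.sys.Pt (Θ.par b) :=
  MoveSys.crossEquiv (S := Θ.sys) (Sum.inl ⟨b, h⟩, true)

theorem up_inc {b : Θ.B} (h : b ≠ Θ.root) (p : Θ.sys.Pt b) :
    Θ.up h (MoveSys.incEquiv b (Θ.acol b) p) =
      MoveSys.incEquiv (Θ.par b) (Θ.acol b) (Θ.up h p) :=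
  MoveSys.crossEquiv_incEquiv (S := Θ.sys) (Sum.inl ⟨b, h⟩, true) p

theorem ev_up {b : Θ.B} (h : b ≠ Θ.root) (p : Θ.sys.Pt b) :
    Θ.model.ev (Θ.up h p).1 = Θ.model.ev p.1 :=
  (MoveSys.Model.ev_crossEquiv Θ.model (Sum.inl ⟨b, h⟩, true) p).trans (mul_one _)

theorem near_up {b : Θ.B} (h : b ≠ Θ.root) (p : Θ.sys.Pt b) :
    Near (flatRel Θ.sys.att) 1 p.out (Θ.up h p).out :=
  MoveSys.near_crossEquiv (S := Θ.sys) (Sum.inl ⟨b, h⟩, true) p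

/-- The action of a generator of valence one on the flats of the type containing its
neighbour. -/
def mulLeaf {u : V} (h : Θ.leaf u) : Equiv.Perm (Θ.sys.Pt (Θ.home (Θ.sup u))) :=
  MoveSys.crossEquiv (S := Θ.sys) (Sum.inr ⟨u, h⟩, true)

theorem mulLeaf_inc {u : V} (h : Θ.leaf u) (p : Θ.sys.Pt (Θ.home (Θ.sup u))) :
    Θ.mulLeaf h (MoveSys.incEquiv _ (Θ.col (Θ.sup u)) p) =
      MoveSys.incEquiv _ (Θ.col (Θ.sup u)) (Θ.mulLeaf h p) :=
  MoveSys.crossEquiv_incEquiv (S := Θ.sys) (Sum.inr ⟨u, h⟩, true) p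

theorem ev_mulLeaf {u : V} (h : Θ.leaf u) (p : Θ.sys.Pt (Θ.home (Θ.sup u))) :
    Θ.model.ev (Θ.mulLeaf h p).1 = Θ.model.ev p.1 * raagGen Γ u :=
  MoveSys.Model.ev_crossEquiv Θ.model (Sum.inr ⟨u, h⟩, true) p

theorem near_mulLeaf {u : V} (h : Θ.leaf u) (p : Θ.sys.Pt (Θ.home (Θ.sup u))) :
    Near (flatRel Θ.sys.att) 1 p.out (Θ.mulLeaf h p).out :=
  MoveSys.near_crossEquiv (S := Θ.sys) (Sum.inr ⟨u, h⟩, true) p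

theorem exists_toRoot : ∃ T : ∀ b, Θ.sys.Pt b ≃ Θ.sys.Pt Θ.root,
    T Θ.root = Equiv.refl _ ∧
      ∀ (b : Θ.B) (h : b ≠ Θ.root), T b = (Θ.up h).trans (T (Θ.par b)) := by
  classical
  let F : ∀ b, (∀ c, Θ.rank c < Θ.rank b → (Θ.sys.Pt c ≃ Θ.sys.Pt Θ.root)) →
      (Θ.sys.Pt b ≃ Θ.sys.Pt Θ.root) := fun b ih =>
    if h : b = Θ.root then Equiv.cast (congrArg Θ.sys.Pt h) else
      (Θ.up h).trans (ih (Θ.par b) (Θ.rank_par b h))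
  have hwf : WellFounded fun c b : Θ.B => Θ.rank c < Θ.rank b := (measure Θ.rank).wf
  refine ⟨hwf.fix F, ?_, ?_⟩
  · rw [hwf.fix_eq]
    exact dif_pos rfl
  · intro b h
    rw [hwf.fix_eq]
    exact dif_neg h

/-- Identification of the flats of type `b` with flats of the root type, by following the path to
the root of the clique tree. -/
def toRoot (b : Θ.B) : Θ.sys.Pt b ≃ Θ.sys.Pt Θ.root := Θ.exists_toRoot.choose b

theorem toRoot_root (p : Θ.sys.Pt Θ.root) : Θ.toRoot Θ.root p = p := by
  rw [toRoot, Θ.exists_toRoot.choose_spec.1]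
  rfl

theorem toRoot_of_ne {b : Θ.B} (h : b ≠ Θ.root) (p : Θ.sys.Pt b) :
    Θ.toRoot b p = Θ.toRoot (Θ.par b) (Θ.up h p) :=
  congrArg (fun e => e p) (Θ.exists_toRoot.choose_spec.2 b h)

theorem ev_toRoot (b : Θ.B) (p : Θ.sys.Pt b) : Θ.model.ev (Θ.toRoot b p).1 = Θ.model.ev p.1 := by
  induction hk : Θ.rank b using Nat.strong_induction_on generalizing b with
  | _ k ih =>
    by_cases h : b = Θ.root
    · subst h
      rw [toRoot_root]
    · rw [Θ.toRoot_of_ne h, ih _ (hk ▸ Θ.rank_par b h) _ _ rfl, ev_up]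

theorem near_toRoot (b : Θ.B) (p : Θ.sys.Pt b) :
    Near (flatRel Θ.sys.att) (Θ.rank b) p.out (Θ.toRoot b p).out := by
  induction hk : Θ.rank b using Nat.strong_induction_on generalizing b with
  | _ k ih =>
    by_cases h : b = Θ.root
    · subst h
      rw [toRoot_root]
      exact Near.refl _ _ _
    · have h0 := Θ.rank_par b h
      rw [Θ.toRoot_of_ne h]
      exact ((Θ.near_up h p).trans (ih _ (hk ▸ h0) (Θ.par b) (Θ.up h p) rfl)).mono (by omega)

/-- Translation of all flats of a given type, identified with flats of the root type, in a
coordinate direction. -/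
def trans (b : Θ.B) (i : Fin n) : Equiv.Perm (Θ.sys.Pt Θ.root) :=
  (Θ.toRoot b).permCongr (MoveSys.incEquiv b i)

theorem trans_toRoot (b : Θ.B) (i : Fin n) (p : Θ.sys.Pt b) :
    Θ.trans b i (Θ.toRoot b p) = Θ.toRoot b (MoveSys.incEquiv b i p) := by
  simp [trans, Equiv.permCongr_apply]

theorem trans_acol {b : Θ.B} (h : b ≠ Θ.root) :
    Θ.trans b (Θ.acol b) = Θ.trans (Θ.par b) (Θ.acol b) := by
  ext p : 1
  obtain ⟨q, rfl⟩ := (Θ.toRoot b).surjective p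
  rw [trans_toRoot, Θ.toRoot_of_ne h, Θ.toRoot_of_ne h, trans_toRoot, up_inc]

open Classical in
/-- The action of a generator on the flats of the root type. -/
def act (v : V) : Equiv.Perm (Θ.sys.Pt Θ.root) :=
  if h : Θ.leaf v then (Θ.toRoot _).permCongr (Θ.mulLeaf h) else Θ.trans (Θ.home v) (Θ.col v)

theorem act_vert (b : Θ.B) (i : Fin n) : Θ.act (Θ.vert b i) = Θ.trans b i := by
  rw [act, dif_neg (Θ.not_leaf_vert b i), Θ.col_vert]
  rcases Θ.home_vert b i with h | ⟨h, rfl⟩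
  · rw [h]
  · rw [Θ.home_acol b h, Θ.trans_acol h]

theorem act_leaf {u : V} (h : Θ.leaf u) (p : Θ.sys.Pt (Θ.home (Θ.sup u))) :
    Θ.act u (Θ.toRoot _ p) = Θ.toRoot _ (Θ.mulLeaf h p) := by
  rw [act, dif_pos h, Equiv.permCongr_apply, Equiv.symm_apply_apply]

theorem act_of_not_leaf {v : V} (h : ¬ Θ.leaf v) : Θ.act v = Θ.trans (Θ.home v) (Θ.col v) :=
  dif_neg h

theorem commute_act_leaf {u : V} (h : Θ.leaf u) : Commute (Θ.act u) (Θ.act (Θ.sup u)) := by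
  ext p : 1
  obtain ⟨q, rfl⟩ := (Θ.toRoot (Θ.home (Θ.sup u))).surjective p
  rw [Θ.act_of_not_leaf (Θ.not_leaf_sup u h), Equiv.Perm.mul_apply, Equiv.Perm.mul_apply,
    Θ.act_leaf h, Θ.trans_toRoot, Θ.act_leaf h, Θ.trans_toRoot, mulLeaf_inc]

theorem commute_act {v w : V} (h : Γ.Adj v w) : Commute (Θ.act v) (Θ.act w) := by
  rcases Θ.adj_cases v w h with ⟨b, i, j, rfl, rfl⟩ | ⟨hl, rfl⟩ | ⟨hl, rfl⟩
  · rw [act_vert, act_vert]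
    ext p : 1
    obtain ⟨q, rfl⟩ := (Θ.toRoot b).surjective p
    rw [Equiv.Perm.mul_apply, Equiv.Perm.mul_apply, trans_toRoot, trans_toRoot, trans_toRoot,
      trans_toRoot, MoveSys.incEquiv_comm]
  · exact Θ.commute_act_leaf hl
  · exact (Θ.commute_act_leaf hl).symm

/-- The action of the right-angled Artin group on the flats of the root type. -/
def hom : Raag Γ →* Equiv.Perm (Θ.sys.Pt Θ.root) :=
  PresentedGroup.toGroup (f := fun v => (Θ.act v)⁻¹) (by
    rintro _ ⟨v, w, h, rfl⟩
    have := (Θ.commute_act h).inv_inv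
    simp only [map_mul, map_inv, FreeGroup.lift_apply_of]
    rw [this.eq, mul_inv_cancel_right, mul_inv_cancel])

theorem hom_gen (v : V) : Θ.hom (raagGen Γ v) = (Θ.act v)⁻¹ :=
  PresentedGroup.toGroup.of _

/-- The base point. -/
def base : Θ.sys.Pt Θ.root := ⟨([], 0), trivial, rfl⟩

/-- The orbit map of the base point. -/
def orb (g : Raag Γ) : Θ.sys.Pt Θ.root := (Θ.hom g)⁻¹ Θ.base

theorem orb_one : Θ.orb 1 = Θ.base := by
  rw [orb, map_one, inv_one, Equiv.Perm.one_apply]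

theorem orb_mul_gen (g : Raag Γ) (v : V) : Θ.orb (g * raagGen Γ v) = Θ.act v (Θ.orb g) := by
  rw [orb, map_mul, mul_inv_rev, hom_gen, inv_inv, Equiv.Perm.mul_apply, orb]

theorem ev_act (v : V) (p : Θ.sys.Pt Θ.root) :
    Θ.model.ev (Θ.act v p).1 = Θ.model.ev p.1 * raagGen Γ v := by
  by_cases h : Θ.leaf v
  · obtain ⟨q, rfl⟩ := (Θ.toRoot (Θ.home (Θ.sup v))).surjective p
    rw [Θ.act_leaf h, ev_toRoot, ev_toRoot, ev_mulLeaf]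
  · obtain ⟨q, rfl⟩ := (Θ.toRoot (Θ.home v)).surjective p
    rw [Θ.act_of_not_leaf h, trans_toRoot, ev_toRoot, ev_toRoot, MoveSys.Model.ev_incEquiv,
      gen_model, Θ.vert_home v h]

theorem ev_orb (g : Raag Γ) : Θ.model.ev (Θ.orb g).1 = g := by
  let H : Subgroup (Raag Γ) :=
    { carrier := {h | ∀ p, Θ.model.ev ((Θ.hom h)⁻¹ p).1 = Θ.model.ev p.1 * h}
      one_mem' := fun p => by rw [map_one, inv_one, Equiv.Perm.one_apply, mul_one]
      mul_mem' := fun {a b} ha hb p => by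
        rw [map_mul, mul_inv_rev, Equiv.Perm.mul_apply, hb, ha, mul_assoc]
      inv_mem' := fun {a} ha p => by
        rw [map_inv, inv_inv, eq_mul_inv_iff_mul_eq, ← ha, ← Equiv.Perm.mul_apply,
          inv_mul_cancel, Equiv.Perm.one_apply] }
  have h : ∀ g, g ∈ H := by
    intro g
    have h1 : Subgroup.closure (Set.range (raagGen Γ)) ≤ H := by
      rw [Subgroup.closure_le]
      rintro _ ⟨v, rfl⟩ p
      rw [hom_gen, inv_inv, ev_act]
    have h2 : Subgroup.closure (Set.range (raagGen Γ)) = ⊤ := PresentedGroup.closure_range_of _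
    exact h1 (h2 ▸ Subgroup.mem_top g)
  refine (h g Θ.base).trans ?_
  rw [base, Θ.model.ev_base, one_mul]

theorem orb_ev (b : Θ.B) (p : Θ.sys.Pt b) : Θ.toRoot b p = Θ.orb (Θ.model.ev p.1) := by
  have hup : ∀ (b : Θ.B) (h : b ≠ Θ.root) (p : Θ.sys.Pt b),
      Θ.toRoot (Θ.par b) (Θ.up h p) = Θ.orb (Θ.model.ev (Θ.up h p).1) ↔
        Θ.toRoot b p = Θ.orb (Θ.model.ev p.1) := fun b h p => by
    rw [← Θ.toRoot_of_ne h, ev_up]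
  have hleaf : ∀ (u : V) (h : Θ.leaf u) (p : Θ.sys.Pt (Θ.home (Θ.sup u))),
      Θ.toRoot _ (Θ.mulLeaf h p) = Θ.orb (Θ.model.ev (Θ.mulLeaf h p).1) ↔
        Θ.toRoot _ p = Θ.orb (Θ.model.ev p.1) := fun u h p => by
    rw [← Θ.act_leaf h, ev_mulLeaf, orb_mul_gen, Equiv.apply_eq_iff_eq]
  refine MoveSys.Pt.induction (Q := fun b p => Θ.toRoot b p = Θ.orb (Θ.model.ev p.1)) ?_ ?_ ?_ b p
  · refine (Θ.toRoot_root _).trans ?_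
    rw [Θ.model.ev_base, orb_one]
    rfl
  · intro b i p
    rw [MoveSys.Model.ev_incEquiv, gen_model, orb_mul_gen, act_vert, ← trans_toRoot,
      Equiv.apply_eq_iff_eq]
  · rintro ⟨⟨b, hb⟩ | ⟨u, hu⟩, _ | _⟩ p hp
    · refine (hup b hb _).1 ?_
      have h : Θ.up hb ((Θ.up hb).symm p) = p := Equiv.apply_symm_apply _ _
      exact (congrArg (fun q => Θ.toRoot (Θ.par b) q = Θ.orb (Θ.model.ev q.1)) h).mpr hp
    · exact (hup b hb p).2 hp
    · refine (hleaf u hu _).1 ?_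
      have h : Θ.mulLeaf hu ((Θ.mulLeaf hu).symm p) = p := Equiv.apply_symm_apply _ _
      exact (congrArg (fun q => Θ.toRoot _ q = Θ.orb (Θ.model.ev q.1)) h).mpr hp
    · exact (hleaf u hu p).2 hp

theorem near_act {R : ℕ} (hR : ∀ b, Θ.rank b ≤ R) (v : V) (p : Θ.sys.Pt Θ.root) :
    Near (flatRel Θ.sys.att) (2 * R + 1) p.out (Θ.act v p).out := by
  by_cases h : Θ.leaf v
  · obtain ⟨q, rfl⟩ := (Θ.toRoot (Θ.home (Θ.sup v))).surjective p
    rw [Θ.act_leaf h]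
    exact (((Θ.near_toRoot _ q).symm.mono (hR _)).trans ((Θ.near_mulLeaf h q).trans
      ((Θ.near_toRoot _ _).mono (hR _)))).mono (by omega)
  · obtain ⟨q, rfl⟩ := (Θ.toRoot (Θ.home v)).surjective p
    rw [Θ.act_of_not_leaf h, trans_toRoot]
    exact (((Θ.near_toRoot _ q).symm.mono (hR _)).trans ((MoveSys.near_incEquiv _ q).trans
      ((Θ.near_toRoot _ _).mono (hR _)))).mono (by omega)

theorem near_elt (g : Raag Γ) (m : Θ.Move) :
    Near (cayleyRel Γ) 1 g (g * Θ.model.elt m) := by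
  obtain ⟨b | u, s⟩ := m
  · rw [elt_inl, mul_one]
    exact Near.refl _ _ _
  · cases s
    · have h : cayleyRel Γ (g * (raagGen Γ u.1)⁻¹) g := ⟨u.1, by rw [inv_mul_cancel_right]⟩
      exact (Near.of_rel h).symm
    · exact Near.of_rel ⟨u.1, rfl⟩

/-- The right-angled Artin group of a clique tree is coarsely equivalent to its tree of flats. -/
theorem coarseEquiv : CoarseEquiv (cayleyRel Γ) (flatRel Θ.sys.att) := by
  obtain ⟨R, hR⟩ : ∃ R, ∀ b, Θ.rank b ≤ R := by
    have := Θ.finite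
    obtain ⟨R, hR⟩ := (Set.finite_range Θ.rank).bddAbove
    exact ⟨R, fun b => hR ⟨b, rfl⟩⟩
  refine ⟨fun g => (Θ.orb g).out, fun p => Θ.model.ev (p.1.1, p.2), 2 * R + 1, ?_, ?_, ?_, ?_⟩
  · rintro g _ ⟨v, rfl⟩
    dsimp only
    rw [orb_mul_gen]
    exact Θ.near_act hR v _
  · rintro _ _ (⟨E, x, j⟩ | ⟨E, L, ⟨_, hE⟩, t, ⟨m, hm, rfl⟩⟩)
    · refine (Near.of_rel ?_).mono (Nat.le_add_left 1 _)
      exact ⟨_, Θ.model.ev_add_single E.1 x j⟩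
    · refine Near.mono (Nat.le_add_left 1 _) ?_
      have h := Θ.model.ev_cons hE t
      dsimp only at h ⊢
      rw [hm] at h
      rw [Line.zero_at, h]
      exact Θ.near_elt _ m
  · intro g
    have h := Θ.ev_orb g
    change Near _ _ (Θ.model.ev (Θ.orb g).1) g
    rw [h]
    exact Near.refl _ _ _
  · rintro ⟨⟨E, hE⟩, x⟩
    have h : Near (flatRel Θ.sys.att) _ (⟨E, hE⟩, x) _ :=
      Θ.near_toRoot (Θ.sys.ty E) ⟨(E, x), hE, rfl⟩
    have h' : Θ.toRoot (Θ.sys.ty E) ⟨(E, x), hE, rfl⟩ = _ := Θ.orb_ev _ _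
    rw [h'] at h
    exact h.symm.mono ((hR _).trans (by omega))

end CliqueTree

/-- The points `a` and `b` are joined by a walk inside `S`. -/
def JoinedWithin {V : Type} (Γ : SimpleGraph V) (S : Set V) (a b : V) : Prop :=
  ∃ p : Γ.Walk a b, ∀ x ∈ p.support, x ∈ S

namespace JoinedWithin

variable {V : Type} {Γ : SimpleGraph V} {S T : Set V} {a b c : V}

theorem refl (h : a ∈ S) : JoinedWithin Γ S a a :=
  ⟨SimpleGraph.Walk.nil, by simpa using h⟩

theorem symm (h : JoinedWithin Γ S a b) : JoinedWithin Γ S b a := by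
  obtain ⟨p, hp⟩ := h
  exact ⟨p.reverse, by simpa using hp⟩

theorem trans (h : JoinedWithin Γ S a b) (h' : JoinedWithin Γ S b c) :
    JoinedWithin Γ S a c := by
  obtain ⟨p, hp⟩ := h
  obtain ⟨q, hq⟩ := h'
  refine ⟨p.append q, fun x hx => ?_⟩
  rcases SimpleGraph.Walk.mem_support_append_iff _ _ |>.1 hx with h | h
  · exact hp x h
  · exact hq x h

theorem of_adj (h : Γ.Adj a b) (ha : a ∈ S) (hb : b ∈ S) : JoinedWithin Γ S a b :=
  ⟨SimpleGraph.Walk.cons h SimpleGraph.Walk.nil, by simp [ha, hb]⟩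

theorem mono (hST : S ⊆ T) (h : JoinedWithin Γ S a b) : JoinedWithin Γ T a b := by
  obtain ⟨p, hp⟩ := h
  exact ⟨p, fun x hx => hST (hp x hx)⟩

theorem reachable (h : JoinedWithin Γ S a b) (ha : a ∈ S) (hb : b ∈ S) :
    (Γ.induce S).Reachable ⟨a, ha⟩ ⟨b, hb⟩ := by
  obtain ⟨p, hp⟩ := h
  exact ⟨p.induce S hp⟩

theorem of_reachable {x y : S} (h : (Γ.induce S).Reachable x y) :
    JoinedWithin Γ S x y := by
  obtain ⟨p⟩ := h
  refine ⟨p.map (SimpleGraph.Embedding.induce S).toHom, fun z hz => ?_⟩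
  have hz' := hz
  erw [SimpleGraph.Walk.support_map, List.mem_map] at hz'
  obtain ⟨w, -, rfl⟩ := hz'
  exact w.2

end JoinedWithin

section BlockStructure

variable {V : Type} {Γ : SimpleGraph V}

theorem preconnected_induce_iff {S : Set V} :
    (Γ.induce S).Preconnected ↔ ∀ a ∈ S, ∀ b ∈ S, JoinedWithin Γ S a b :=
  ⟨fun h a ha b hb => JoinedWithin.of_reachable (h ⟨a, ha⟩ ⟨b, hb⟩),
    fun h a b => (h a a.2 b b.2).reachable a.2 b.2⟩

theorem preconnected_induce_of_center {S : Set V} (c : V)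
    (h : ∀ a ∈ S, JoinedWithin Γ S a c) : (Γ.induce S).Preconnected :=
  preconnected_induce_iff.2 fun a ha b hb => (h a ha).trans (h b hb).symm

theorem not_cutVertex_of_center {v : V} (c : V)
    (h : ∀ a, a ≠ v → JoinedWithin Γ {u | u ≠ v} a c) : ¬ CutVertex Γ v :=
  not_not.2 (preconnected_induce_of_center c h)

theorem biconn_of_isClique {S : Set V} (hS : Γ.IsClique S) (hne : S.Nonempty) : Biconn Γ S := by
  have key : ∀ T : Set V, T ⊆ S → (Γ.induce T).Preconnected := fun T hT =>
    preconnected_induce_iff.2 fun a ha b hb => by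
      by_cases hab : a = b
      · subst hab
        exact JoinedWithin.refl ha
      · exact JoinedWithin.of_adj (hS (hT ha) (hT hb) hab) ha hb
  have := hne.to_subtype
  exact ⟨⟨key S subset_rfl⟩, fun x _ => key _ Set.sdiff_subset⟩

theorem exists_maxBiconn [Finite V] {S : Set V} (hS : Biconn Γ S) :
    ∃ T, S ⊆ T ∧ MaxBiconn Γ T := by
  obtain ⟨T, hST, hT⟩ := (Set.toFinite {T : Set V | Biconn Γ T}).exists_le_maximal hS
  exact ⟨T, hST, hT.1, fun T' hT' h => h.antisymm (hT.2 hT' h)⟩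

theorem exists_walk_avoiding {a z x : V} (q : Γ.Walk a z) (hq : q.IsPath) (hx : x ∈ q.support)
    (hxz : x ≠ z) : ∃ q' : Γ.Walk a x, ∀ u ∈ q'.support, u ∈ q.support ∧ u ≠ z := by
  classical
  refine ⟨q.takeUntil x hx, fun u hu => ⟨q.support_takeUntil_subset_support hx hu, ?_⟩⟩
  rintro rfl
  exact SimpleGraph.Walk.endpoint_notMem_support_takeUntil hq hx hxz.symm hu

theorem biconn_cycle {v y y' : V} (hy : Γ.Adj y v) (hy' : Γ.Adj y' v) (p : Γ.Walk y y')
    (hp : p.IsPath) (hv : v ∉ p.support) : Biconn Γ {x | x = v ∨ x ∈ p.support} := by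
  classical
  have key : ∀ z, z ∈ p.support → ∀ x ∈ p.support, x ≠ z →
      JoinedWithin Γ ({x | x = v ∨ x ∈ p.support} \ {z}) x v := by
    intro z hz x hx hxz
    have hvz : v ≠ z := by
      rintro rfl
      exact hv hz
    have fin : ∀ {a : V} (q : Γ.Walk a z), q.IsPath → x ∈ q.support → Γ.Adj a v →
        (∀ u ∈ q.support, u ∈ p.support) →
        JoinedWithin Γ ({x | x = v ∨ x ∈ p.support} \ {z}) x v := by
      intro a q hq hxq ha hsub
      obtain ⟨q', hq'⟩ := exists_walk_avoiding q hq hxq hxz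
      have h1 : JoinedWithin Γ ({x | x = v ∨ x ∈ p.support} \ {z}) a x :=
        ⟨q', fun u hu => ⟨Or.inr (hsub u (hq' u hu).1), (hq' u hu).2⟩⟩
      obtain ⟨ha1, ha2⟩ := hq' a q'.start_mem_support
      exact h1.symm.trans (JoinedWithin.of_adj ha ⟨Or.inr (hsub a ha1), ha2⟩ ⟨Or.inl rfl, hvz⟩)
    have hx' : x ∈ ((p.takeUntil z hz).append (p.dropUntil z hz)).support := by
      rwa [p.take_spec hz]
    rcases (SimpleGraph.Walk.mem_support_append_iff _ _).1 hx' with h | h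
    · exact fin _ (hp.takeUntil hz) h hy fun u hu => p.support_takeUntil_subset_support hz hu
    · refine fin (p.dropUntil z hz).reverse (hp.dropUntil hz).reverse (by simpa using h) hy'
        fun u hu => p.support_dropUntil_subset_support hz (by simpa using hu)
  have toy : ∀ S : Set V, (∀ u ∈ p.support, u ∈ S) → ∀ x ∈ p.support, JoinedWithin Γ S x y :=
    fun S hS x hx => by
      refine JoinedWithin.symm ⟨p.takeUntil x hx, fun u hu => hS u ?_⟩
      exact p.support_takeUntil_subset_support hx hu
  have hvy : JoinedWithin Γ {x | x = v ∨ x ∈ p.support} v y :=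
    JoinedWithin.of_adj hy.symm (Or.inl rfl) (Or.inr p.start_mem_support)
  constructor
  · have : Nonempty {x | x = v ∨ x ∈ p.support} := ⟨⟨v, Or.inl rfl⟩⟩
    refine ⟨preconnected_induce_of_center y ?_⟩
    rintro x (rfl | hx)
    · exact hvy
    · exact toy _ (fun u hu => Or.inr hu) x hx
  · rintro z (rfl | hz)
    · refine preconnected_induce_of_center y ?_
      rintro x ⟨rfl | hx, hxz⟩
      · exact absurd rfl hxz
      · refine toy _ ?_ x hx
        intro u hu
        refine ⟨Or.inr hu, ?_⟩
        rintro rfl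
        exact hv hu
    · refine preconnected_induce_of_center v ?_
      rintro x ⟨rfl | hx, hxz⟩
      · exact JoinedWithin.refl ⟨Or.inl rfl, hxz⟩
      · exact key z hz x hx hxz

/-- Two neighbours of `v` that are joined away from `v` are adjacent, provided that the blocks are
cliques. -/
theorem adj_of_joinedWithin [Finite V] (hcl : ∀ S, MaxBiconn Γ S → Γ.IsClique S) {v y y' : V}
    (hy : Γ.Adj y v) (hy' : Γ.Adj y' v) (hne : y ≠ y')
    (h : JoinedWithin Γ {u | u ≠ v} y y') : Γ.Adj y y' := by
  classical
  obtain ⟨p, hp⟩ := h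
  have hv : v ∉ p.bypass.support := fun hv => hp v (p.support_bypass_subset_support hv) rfl
  obtain ⟨T, hST, hT⟩ := exists_maxBiconn (biconn_cycle hy hy' p.bypass p.bypass_isPath hv)
  exact hcl T hT (hST (Or.inr p.bypass.start_mem_support))
    (hST (Or.inr p.bypass.end_mem_support)) hne

end BlockStructure

/-- An `n`-clique tree-graded graph rooted at an edge joining two cut vertices. -/
structure RootedTreeGraded {V : Type} (Γ : SimpleGraph V) (n : ℕ) where
  graded : NCliqueTreeGraded Γ n
  two_le : 2 ≤ n
  r : V
  w₀ : V
  adj : Γ.Adj w₀ r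
  cut_r : CutVertex Γ r
  cut_w₀ : CutVertex Γ w₀

theorem NCliqueTreeGraded.cutVertex_of_adj {V : Type} {Γ : SimpleGraph V} {n : ℕ}
    (h : NCliqueTreeGraded Γ n) {a b x : V} (ha : Γ.Adj a x) (hb : Γ.Adj b x) (hab : a ≠ b) :
    CutVertex Γ x :=
  (h.2.1 x).resolve_right fun ⟨_, _, hu⟩ => hab ((hu a ha.symm).trans (hu b hb.symm).symm)

theorem exists_adj_dist_add_one {V : Type} {Γ : SimpleGraph V} (hΓ : Γ.Connected) {r v : V}
    (h : v ≠ r) : ∃ y, Γ.Adj y v ∧ Γ.dist r y + 1 = Γ.dist r v := by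
  obtain ⟨p, hp⟩ := hΓ.exists_walk_length_eq_dist v r
  cases p with
  | nil => exact absurd rfl h
  | @cons _ y _ hvy q =>
    refine ⟨y, hvy.symm, ?_⟩
    have h1 := SimpleGraph.dist_le q
    have h2 := hΓ.dist_triangle (u := v) (v := y) (w := r)
    have h3 := SimpleGraph.dist_eq_one_iff_adj.2 hvy
    rw [SimpleGraph.Walk.length_cons] at hp
    rw [SimpleGraph.dist_comm (u := r) (v := y), SimpleGraph.dist_comm (u := r) (v := v)]
    omega

theorem NCliqueTreeGraded.nonempty_rooted {V : Type} {Γ : SimpleGraph V} {n : ℕ}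
    (h : NCliqueTreeGraded Γ n) (hn : 2 ≤ n) : Nonempty (RootedTreeGraded Γ n) := by
  obtain ⟨x, y, hxy⟩ := h.2.2.1
  have step : ∀ v, 0 < Γ.dist x v → ∃ y, Γ.Adj y v ∧ Γ.dist x y + 1 = Γ.dist x v := by
    intro v hv
    refine exists_adj_dist_add_one h.1 ?_
    rintro rfl
    simp at hv
  obtain ⟨y₁, ha₁, h₁⟩ := step y (by omega)
  obtain ⟨y₂, ha₂, h₂⟩ := step y₁ (by omega)
  obtain ⟨y₃, ha₃, h₃⟩ := step y₂ (by omega)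
  refine ⟨⟨h, hn, y₂, y₁, ha₂.symm, h.cutVertex_of_adj ha₃ ha₂.symm ?_,
    h.cutVertex_of_adj ha₂ ha₁.symm ?_⟩⟩ <;>
  · rintro rfl
    omega

namespace RootedTreeGraded

variable {V : Type} {Γ : SimpleGraph V} {n : ℕ} (R : RootedTreeGraded Γ n)

/-- The distance to the base point. -/
def depth (v : V) : ℕ := Γ.dist R.r v

theorem exists_pred (v : V) : ∃ y, v ≠ R.r → Γ.Adj y v ∧ R.depth y + 1 = R.depth v := by
  by_cases h : v = R.r
  · exact ⟨v, fun h' => absurd h h'⟩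
  · obtain ⟨y, hy⟩ := exists_adj_dist_add_one R.graded.1 h
    exact ⟨y, fun _ => hy⟩

/-- The neighbour of `v` that is closer to the base point. -/
def pred (v : V) : V := (R.exists_pred v).choose

variable {R} {v w x y : V}

theorem adj_pred (h : v ≠ R.r) : Γ.Adj (R.pred v) v := ((R.exists_pred v).choose_spec h).1

theorem depth_pred (h : v ≠ R.r) : R.depth (R.pred v) + 1 = R.depth v :=
  ((R.exists_pred v).choose_spec h).2

theorem depth_eq_zero : R.depth v = 0 ↔ v = R.r :=
  R.graded.1.dist_eq_zero_iff.trans eq_comm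

theorem depth_root : R.depth R.r = 0 := depth_eq_zero.2 rfl

theorem depth_of_adj (h : Γ.Adj v w) :
    R.depth v = R.depth w ∨ R.depth v = R.depth w + 1 ∨ R.depth v + 1 = R.depth w := by
  have h1 := R.graded.1.dist_triangle (u := R.r) (v := v) (w := w)
  have h2 := R.graded.1.dist_triangle (u := R.r) (v := w) (w := v)
  have h3 := SimpleGraph.dist_eq_one_iff_adj.2 h
  have h4 := SimpleGraph.dist_eq_one_iff_adj.2 h.symm
  unfold depth
  omega

theorem joinedWithin_root (v a : V) (h : R.depth a ≤ R.depth v) (hne : a ≠ v) :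
    JoinedWithin Γ {u | u ≠ v} a R.r := by
  induction hk : R.depth a using Nat.strong_induction_on generalizing a with
  | _ k ih =>
    by_cases har : a = R.r
    · subst har
      exact JoinedWithin.refl hne
    · have hd := depth_pred har
      have hp : R.pred a ≠ v := by
        rintro rfl
        omega
      exact (JoinedWithin.of_adj (adj_pred har).symm hne hp).trans
        (ih _ (by omega) (R.pred a) (by omega) hp rfl)

theorem isClique_of_maxBiconn (R : RootedTreeGraded Γ n) {S : Set V} (hS : MaxBiconn Γ S) :
    Γ.IsClique S :=
  (R.graded.2.2.2 S hS).elim (fun h => h.1) fun h => h.1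

theorem adj_of_depth_le [Finite V] (hx : Γ.Adj x v) (hy : Γ.Adj y v) (hne : x ≠ y)
    (hdx : R.depth x ≤ R.depth v) (hdy : R.depth y ≤ R.depth v) : Γ.Adj x y :=
  adj_of_joinedWithin (fun _ => R.isClique_of_maxBiconn) hx hy hne
    ((joinedWithin_root v x hdx hx.ne).trans (joinedWithin_root v y hdy hy.ne).symm)

theorem eq_pred [Finite V] (hy : Γ.Adj y v) (hd : R.depth y + 1 = R.depth v) : y = R.pred v := by
  have hv : v ≠ R.r := by
    rintro rfl
    rw [depth_root] at hd
    omega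
  have hp := depth_pred hv
  by_contra hne
  have hadj : Γ.Adj y (R.pred v) :=
    adj_of_depth_le (R := R) hy (adj_pred hv) hne (by omega) (by omega)
  by_cases hyr : y = R.r
  · have h0 : R.depth y = 0 := depth_eq_zero.2 hyr
    exact hne (hyr.trans (depth_eq_zero.1 (by omega)).symm)
  · have hz := depth_pred hyr
    have hz' : R.pred y ≠ R.pred v := by
      intro h
      rw [h] at hz
      omega
    have h1 : Γ.Adj (R.pred y) (R.pred v) :=
      adj_of_depth_le (R := R) (adj_pred hyr) hadj.symm hz' (by omega) (by omega)
    have hzy : R.pred y ≠ y := (adj_pred hyr).ne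
    have hzv : R.pred y ≠ v := by
      intro h
      rw [h] at hz
      omega
    have h2 : JoinedWithin Γ {u | u ≠ y} (R.pred y) v :=
      (JoinedWithin.of_adj h1 hzy (Ne.symm hne)).trans
        (JoinedWithin.of_adj (adj_pred hv) (Ne.symm hne) hy.ne')
    have h3 : Γ.Adj (R.pred y) v :=
      adj_of_joinedWithin (fun _ => R.isClique_of_maxBiconn) (adj_pred hyr) hy.symm hzv h2
    have := R.depth_of_adj h3
    omega

theorem pred_eq_pred [Finite V] (h : Γ.Adj v w) (hd : R.depth v = R.depth w) :
    R.pred v = R.pred w := by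
  have hv : v ≠ R.r := by
    rintro rfl
    exact h.ne (depth_eq_zero.1 (hd.symm.trans depth_root)).symm
  have hp := depth_pred hv
  have hne : R.pred v ≠ w := by
    intro h
    rw [h] at hp
    omega
  exact eq_pred (adj_of_depth_le (R := R) (adj_pred hv) h.symm hne (by omega) (by omega)) (by omega)

/-- The block containing `v` and its predecessor. -/
def block (R : RootedTreeGraded Γ n) (v : V) : Set V :=
  {x | x = R.pred v ∨ (x ≠ R.r ∧ R.pred x = R.pred v ∧ (x = v ∨ Γ.Adj x v))}

theorem mem_block (hv : v ≠ R.r) : v ∈ R.block v := Or.inr ⟨hv, rfl, Or.inl rfl⟩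

theorem pred_mem_block : R.pred v ∈ R.block v := Or.inl rfl

theorem isClique_block [Finite V] (hv : v ≠ R.r) : Γ.IsClique (R.block v) := by
  have hp := depth_pred hv
  rintro a (rfl | ⟨ha, hpa, hav⟩) b (rfl | ⟨hb, hpb, hbv⟩) hab
  · exact absurd rfl hab
  · exact hpb ▸ adj_pred hb
  · exact hpa ▸ (adj_pred ha).symm
  · have hda := depth_pred ha
    have hdb := depth_pred hb
    rw [hpa] at hda
    rw [hpb] at hdb
    rcases hav with rfl | hav
    · exact (hbv.resolve_left hab.symm).symm
    · rcases hbv with rfl | hbv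
      · exact hav
      · exact adj_of_depth_le (R := R) hav hbv hab (by omega) (by omega)

theorem subset_block [Finite V] (hv : v ≠ R.r) {S : Set V} (hS : Γ.IsClique S)
    (hsub : R.block v ⊆ S) : S ⊆ R.block v := by
  intro x hx
  have hp := depth_pred hv
  by_cases hxv : x = v
  · rw [hxv]
    exact mem_block hv
  by_cases hxp : x = R.pred v
  · exact Or.inl hxp
  have h1 : Γ.Adj x v := hS hx (hsub (mem_block hv)) hxv
  have h2 : Γ.Adj x (R.pred v) := hS hx (hsub pred_mem_block) hxp
  rcases R.depth_of_adj h1 with h | h | h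
  · refine Or.inr ⟨?_, pred_eq_pred h1 h, Or.inr h1⟩
    rintro rfl
    rw [depth_root] at h
    omega
  · have := R.depth_of_adj h2
    omega
  · exact absurd (eq_pred h1 h) hxp

theorem maxBiconn_block [Finite V] (hv : v ≠ R.r) : MaxBiconn Γ (R.block v) := by
  refine ⟨biconn_of_isClique (isClique_block hv) ⟨v, mem_block hv⟩, fun T hT hsub => ?_⟩
  obtain ⟨S, hTS, hS⟩ := exists_maxBiconn hT
  exact hsub.antisymm
    (hTS.trans (subset_block hv (R.isClique_of_maxBiconn hS) (hsub.trans hTS)))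

theorem ne_root_of_mem_block (hw : w ∈ R.block v) (hne : w ≠ R.pred v) :
    w ≠ R.r ∧ R.pred w = R.pred v :=
  (hw.resolve_left hne).imp_right And.left

theorem block_subset [Finite V] (hv : v ≠ R.r) (hw : w ∈ R.block v) (hne : w ≠ R.pred v) :
    R.block w ⊆ R.block v := by
  obtain ⟨hwr, hpw, hwv⟩ := hw.resolve_left hne
  have hdw := depth_pred hwr
  have hdv := depth_pred hv
  rintro x (rfl | ⟨hx, hpx, hxw⟩)
  · exact Or.inl hpw
  · refine Or.inr ⟨hx, hpx.trans hpw, ?_⟩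
    have hdx := depth_pred hx
    rw [hpx] at hdx
    rw [hpw] at hdx hdw
    by_cases hxv : x = v
    · exact Or.inl hxv
    · refine Or.inr ?_
      rcases hxw with rfl | hxw
      · exact hwv.resolve_left hxv
      · rcases hwv with rfl | hwv
        · exact hxw
        · exact adj_of_depth_le (R := R) hxw hwv.symm hxv (by omega) (by omega)

theorem block_eq [Finite V] (hv : v ≠ R.r) (hw : w ∈ R.block v) (hne : w ≠ R.pred v) :
    R.block w = R.block v := by
  obtain ⟨hwr, hpw, hwv⟩ := hw.resolve_left hne
  refine (block_subset hv hw hne).antisymm (block_subset hwr ?_ ?_)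
  · exact Or.inr ⟨hv, hpw.symm, hwv.imp Eq.symm SimpleGraph.Adj.symm⟩
  · rw [hpw]
    exact (adj_pred hv).ne'

theorem pred_eq_of_block_eq (h : R.block v = R.block w) :
    R.pred v = R.pred w := by
  by_contra hne
  have h1 : R.pred v ∈ R.block w := h ▸ pred_mem_block
  have h2 : R.pred w ∈ R.block v := h ▸ pred_mem_block
  obtain ⟨h3, h4⟩ := ne_root_of_mem_block h1 hne
  obtain ⟨h5, h6⟩ := ne_root_of_mem_block h2 (Ne.symm hne)
  have h7 := depth_pred h3
  have h8 := depth_pred h5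
  rw [h4] at h7
  rw [h6] at h8
  omega

theorem cut_pred (hv : v ≠ R.r) : CutVertex Γ (R.pred v) := by
  by_cases h : R.pred v = R.r
  · rw [h]
    exact R.cut_r
  · refine R.graded.cutVertex_of_adj (adj_pred h) (adj_pred hv).symm ?_
    intro h'
    have h1 := depth_pred h
    have h2 := depth_pred hv
    rw [h'] at h1
    omega

theorem block_of_cut [Finite V] (hv : v ≠ R.r) (hc : CutVertex Γ v) :
    (R.block v).ncard = n ∧ ∀ x ∈ R.block v, CutVertex Γ x := by
  rcases R.graded.2.2.2 _ (maxBiconn_block hv) with h | ⟨-, -, x, -, hx⟩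
  · exact h.2
  · exact absurd ((hx _ ⟨pred_mem_block, cut_pred hv⟩).trans (hx _ ⟨mem_block hv, hc⟩).symm)
      (adj_pred hv).ne

theorem ne_root_of_not_cut (hv : ¬ CutVertex Γ v) : v ≠ R.r := by
  rintro rfl
  exact hv R.cut_r

theorem exists_pred_eq (hc : CutVertex Γ v) : ∃ w, w ≠ R.r ∧ R.pred w = v := by
  by_contra! h
  refine not_cutVertex_of_center R.r (fun a ha => ?_) hc
  induction hk : R.depth a using Nat.strong_induction_on generalizing a with
  | _ k ih =>
    by_cases har : a = R.r
    · subst har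
      exact JoinedWithin.refl ha
    · have hd := depth_pred har
      exact (JoinedWithin.of_adj (adj_pred har).symm ha (h a har)).trans
        (ih _ (by omega) (R.pred a) (h a har) rfl)

theorem w₀_ne_root : R.w₀ ≠ R.r := R.adj.ne

theorem pred_w₀ [Finite V] : R.pred R.w₀ = R.r := by
  refine (eq_pred R.adj.symm ?_).symm
  rw [depth_root]
  exact (SimpleGraph.dist_eq_one_iff_adj.2 R.adj.symm).symm

theorem exists_pred_eq_root [Finite V] :
    ∃ w, w ≠ R.r ∧ R.pred w = R.r ∧ R.block w ≠ R.block R.w₀ := by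
  by_contra! h
  refine not_cutVertex_of_center R.w₀ (fun a ha => ?_) R.cut_r
  induction hk : R.depth a using Nat.strong_induction_on generalizing a with
  | _ k ih =>
    have har : a ≠ R.r := ha
    have hd := depth_pred har
    by_cases hp : R.pred a = R.r
    · by_cases haw : a = R.w₀
      · subst haw
        exact JoinedWithin.refl ha
      · have hmem : a ∈ R.block R.w₀ := h a har hp ▸ mem_block har
        exact JoinedWithin.of_adj (isClique_block w₀_ne_root hmem (mem_block w₀_ne_root) haw)
          ha w₀_ne_root
    · exact (JoinedWithin.of_adj (adj_pred har).symm ha hp).trans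
        (ih _ (by omega) (R.pred a) hp rfl)

end RootedTreeGraded

namespace RootedTreeGraded

variable {V : Type} {Γ : SimpleGraph V} {n : ℕ} (R : RootedTreeGraded Γ n)

open Classical in
/-- A map to `Fin n` that is injective on `S` if there is one. -/
def setColor (S : Set V) : V → Fin n :=
  if h : ∃ g : V → Fin n, Set.InjOn g S then h.choose
  else fun _ => ⟨0, by have := R.two_le; omega⟩

open Classical in
/-- A colouring of the vertices that is injective on every block. -/
def color (v : V) : Fin n :=
  if h : v = R.r then ⟨0, by have := R.two_le; omega⟩
  else Equiv.swap (R.setColor (R.block v) (R.pred v)) (color (R.pred v))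
    (R.setColor (R.block v) v)
termination_by R.depth v
decreasing_by
  have := depth_pred h
  omega

variable {R} {v w x : V}

theorem ncard_block_le [Finite V] (hv : v ≠ R.r) : (R.block v).ncard ≤ n := by
  rcases R.graded.2.2.2 _ (maxBiconn_block hv) with h | h
  · exact h.2.1.le
  · exact h.2.1.le.trans R.two_le

theorem injOn_setColor [Finite V] (hv : v ≠ R.r) :
    Set.InjOn (R.setColor (R.block v)) (R.block v) := by
  have h : ∃ g : V → Fin n, Set.InjOn g (R.block v) := by
    have hle := ncard_block_le hv
    rw [← Nat.card_coe_set_eq] at hle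
    obtain ⟨f⟩ : Nonempty (R.block v ↪ Fin n) := by
      have := Fintype.ofFinite (R.block v)
      rw [Function.Embedding.nonempty_iff_card_le, Fintype.card_fin, ← Nat.card_eq_fintype_card]
      exact hle
    classical
    refine ⟨fun x => if hx : x ∈ R.block v then f ⟨x, hx⟩ else f ⟨v, mem_block hv⟩, ?_⟩
    intro a ha b hb hab
    simp only [ha, hb, dif_pos] at hab
    exact congrArg Subtype.val (f.injective hab)
  rw [setColor, dif_pos h]
  exact h.choose_spec

theorem color_of_mem [Finite V] (hv : v ≠ R.r) (hw : w ∈ R.block v) :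
    R.color w = Equiv.swap (R.setColor (R.block v) (R.pred v)) (R.color (R.pred v))
      (R.setColor (R.block v) w) := by
  by_cases hne : w = R.pred v
  · rw [hne, Equiv.swap_apply_left]
  · obtain ⟨h1, h2⟩ := ne_root_of_mem_block hw hne
    rw [color, dif_neg h1, block_eq hv hw hne, h2]

theorem injOn_color [Finite V] (hv : v ≠ R.r) : Set.InjOn R.color (R.block v) := by
  intro a ha b hb hab
  rw [color_of_mem hv ha, color_of_mem hv hb] at hab
  exact injOn_setColor hv ha hb ((Equiv.injective _) hab)

variable (R)

/-- The blocks that consist of cut vertices. -/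
def Block : Type := {S : Set V // ∃ w, w ≠ R.r ∧ S = R.block w ∧ ∀ x ∈ S, CutVertex Γ x}

variable {R}

/-- The block containing a cut vertex `v` and its predecessor. -/
def toBlock [Finite V] (hv : v ≠ R.r) (hc : CutVertex Γ v) : R.Block :=
  ⟨R.block v, v, hv, rfl, (block_of_cut hv hc).2⟩

variable (R) in
/-- The base block. -/
def rootBlock [Finite V] : R.Block := toBlock w₀_ne_root R.cut_w₀

open Classical in
variable (R) in
/-- The block nearest to the base block containing the cut vertex `v`. -/
def homeBlock [Finite V] (v : V) : R.Block :=
  if h : v ≠ R.r ∧ CutVertex Γ v then toBlock h.1 h.2 else R.rootBlock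

namespace Block

variable {S : R.Block}

/-- The vertex of a block that is closest to the base point. -/
def att (S : R.Block) : V := R.pred S.2.choose

theorem att_eq (h : S.1 = R.block v) : S.att = R.pred v :=
  pred_eq_of_block_eq (S.2.choose_spec.2.1.symm.trans h)

theorem att_mem (S : R.Block) : S.att ∈ S.1 := by
  obtain ⟨w, -, h, -⟩ := S.2
  rw [att_eq h, h]
  exact pred_mem_block

theorem cut (S : R.Block) (h : x ∈ S.1) : CutVertex Γ x := by
  obtain ⟨w, -, -, hc⟩ := S.2
  exact hc x h

theorem adj [Finite V] (S : R.Block) (hv : v ∈ S.1) (hw : w ∈ S.1) (hne : v ≠ w) :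
    Γ.Adj v w := by
  obtain ⟨u, hu, h, -⟩ := S.2
  rw [h] at hv hw
  exact isClique_block hu hv hw hne

theorem eq_block_of_ne_att [Finite V] (S : R.Block) (h : x ∈ S.1) (hne : x ≠ S.att) :
    x ≠ R.r ∧ S.1 = R.block x := by
  obtain ⟨u, hu, hS, -⟩ := S.2
  rw [hS] at h
  rw [att_eq hS] at hne
  exact ⟨(ne_root_of_mem_block h hne).1, hS.trans (block_eq hu h hne).symm⟩

theorem injOn_color [Finite V] (S : R.Block) : Set.InjOn R.color S.1 := by
  obtain ⟨u, hu, h, -⟩ := S.2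
  rw [h]
  exact RootedTreeGraded.injOn_color hu

theorem exists_color_eq [Finite V] (S : R.Block) (i : Fin n) : ∃ x ∈ S.1, R.color x = i := by
  have hn : S.1.ncard = n := by
    obtain ⟨u, hu, h, hc⟩ := S.2
    rw [h] at hc ⊢
    exact (block_of_cut hu (hc u (mem_block hu))).1
  have himg : R.color '' S.1 = Set.univ := by
    refine Set.eq_of_subset_of_ncard_le (Set.subset_univ _) ?_
    rw [S.injOn_color.ncard_image, hn, Set.ncard_univ, Nat.card_fin]
  have : i ∈ R.color '' S.1 := himg ▸ Set.mem_univ i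
  exact this

/-- The vertex of the block of a given colour. -/
def vert [Finite V] (S : R.Block) (i : Fin n) : V := (S.exists_color_eq i).choose

theorem vert_mem [Finite V] (S : R.Block) (i : Fin n) : S.vert i ∈ S.1 :=
  (S.exists_color_eq i).choose_spec.1

theorem color_vert [Finite V] (S : R.Block) (i : Fin n) : R.color (S.vert i) = i :=
  (S.exists_color_eq i).choose_spec.2

theorem vert_color [Finite V] (S : R.Block) (h : x ∈ S.1) : S.vert (R.color x) = x :=
  S.injOn_color (S.vert_mem _) h (S.color_vert _)

end Block

section Home

variable [Finite V]

theorem homeBlock_of_ne (h : v ≠ R.r) (hc : CutVertex Γ v) : R.homeBlock v = toBlock h hc :=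
  dif_pos ⟨h, hc⟩

theorem homeBlock_root : R.homeBlock R.r = R.rootBlock :=
  dif_neg fun h => h.1 rfl

theorem att_rootBlock : R.rootBlock.att = R.r :=
  (Block.att_eq (v := R.w₀) rfl).trans pred_w₀

theorem mem_homeBlock (hc : CutVertex Γ v) : v ∈ (R.homeBlock v).1 := by
  by_cases h : v = R.r
  · subst h
    rw [homeBlock_root]
    have h := R.rootBlock.att_mem
    rwa [att_rootBlock] at h
  · rw [homeBlock_of_ne h hc]
    exact mem_block h

theorem homeBlock_eq {S : R.Block} (h : v ∈ S.1) (hne : v ≠ S.att) : R.homeBlock v = S := by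
  obtain ⟨h1, h2⟩ := S.eq_block_of_ne_att h hne
  rw [homeBlock_of_ne h1 (S.cut h)]
  exact Subtype.ext h2.symm

open Classical in
/-- The height of a block above the base block. -/
def Block.rank (S : R.Block) : ℕ := if S = R.rootBlock then 0 else R.depth S.att + 1

theorem rank_homeBlock_att {S : R.Block} (h : S ≠ R.rootBlock) :
    (R.homeBlock S.att).rank < S.rank := by
  have hS : S.rank = R.depth S.att + 1 := if_neg h
  by_cases hr : S.att = R.r
  · rw [hr, homeBlock_root, hS, Block.rank, if_pos rfl]
    omega
  · have hd := depth_pred hr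
    have hatt : (R.homeBlock S.att).att = R.pred S.att := by
      rw [homeBlock_of_ne hr (S.cut S.att_mem)]
      exact Block.att_eq rfl
    rw [hS]
    unfold Block.rank
    split_ifs
    · omega
    · rw [hatt]
      omega

theorem exists_block_or_leaf (h : Γ.Adj v w) (hd : R.depth v ≤ R.depth w) :
    (∃ S : R.Block, v ∈ S.1 ∧ w ∈ S.1) ∨ (¬ CutVertex Γ w ∧ v = R.pred w) := by
  by_cases heq : R.depth v = R.depth w
  · have hv : v ≠ R.r := by
      rintro rfl
      exact h.ne (depth_eq_zero.1 (heq.symm.trans depth_root)).symm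
    have hw : w ≠ R.r := by
      rintro rfl
      exact h.ne (depth_eq_zero.1 (heq.trans depth_root))
    have hp := pred_eq_pred h heq
    have hc : CutVertex Γ w := by
      refine R.graded.cutVertex_of_adj h (adj_pred hw) ?_
      rw [← hp]
      exact (adj_pred hv).ne'
    exact Or.inl ⟨toBlock hw hc, Or.inr ⟨hv, hp, Or.inr h⟩, mem_block hw⟩
  · have hvw : v = R.pred w := by
      have := R.depth_of_adj h
      exact eq_pred h (by omega)
    by_cases hc : CutVertex Γ w
    · have hw : w ≠ R.r := by
        rintro rfl
        rw [depth_root] at hd heq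
        omega
      exact Or.inl ⟨toBlock hw hc, Or.inl hvw, mem_block hw⟩
    · exact Or.inr ⟨hc, hvw⟩

theorem exists_child_or_leaf (hc : CutVertex Γ x) :
    (∃ S : R.Block, S ≠ R.rootBlock ∧ S.att = x) ∨ ∃ u, ¬ CutVertex Γ u ∧ R.pred u = x := by
  obtain ⟨w, hw, hwx, hne⟩ :
      ∃ w, w ≠ R.r ∧ R.pred w = x ∧ R.block w ≠ R.block R.w₀ := by
    by_cases hx : x = R.r
    · subst hx
      exact exists_pred_eq_root
    · obtain ⟨w, hw, hwx⟩ := exists_pred_eq hc (R := R)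
      refine ⟨w, hw, hwx, fun h => hx ?_⟩
      rw [← hwx, pred_eq_of_block_eq h, pred_w₀]
  by_cases hcw : CutVertex Γ w
  · refine Or.inl ⟨toBlock hw hcw, fun h => hne (congrArg Subtype.val h), ?_⟩
    exact (Block.att_eq rfl).trans hwx
  · exact Or.inr ⟨w, hcw, hwx⟩

variable (R) in
/-- The tree of blocks of an `n`-clique tree-graded graph. -/
def cliqueTree : CliqueTree Γ n where
  B := R.Block
  finite := inferInstanceAs (Finite {S : Set V // _})
  root := R.rootBlock
  par S := R.homeBlock S.att
  rank := Block.rank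
  rank_par _ h := rank_homeBlock_att h
  vert := Block.vert
  col := R.color
  acol S := R.color S.att
  home := R.homeBlock
  leaf v := ¬ CutVertex Γ v
  sup := R.pred
  adj_vert S i j hij := S.adj (S.vert_mem i) (S.vert_mem j) fun h => hij <| by
    rw [← S.color_vert i, h, S.color_vert j]
  col_vert := Block.color_vert
  not_leaf_vert S i := not_not.2 (S.cut (S.vert_mem i))
  home_vert S i := by
    by_cases h : S.vert i = S.att
    · by_cases hS : S = R.rootBlock
      · left
        rw [h, hS, att_rootBlock, homeBlock_root]
      · exact Or.inr ⟨hS, by rw [← h, S.color_vert]⟩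
    · exact Or.inl (homeBlock_eq (S.vert_mem i) h)
  vert_acol S _ := by
    rw [S.vert_color S.att_mem, Block.vert_color _ (mem_homeBlock (S.cut S.att_mem))]
  home_acol S _ := by rw [S.vert_color S.att_mem]
  vert_home v hv := Block.vert_color _ (mem_homeBlock (not_not.1 hv))
  not_leaf_sup u hu := not_not.2 (cut_pred (ne_root_of_not_cut hu))
  adj_sup u hu := (adj_pred (ne_root_of_not_cut hu)).symm
  adj_cases v w h := by
    have block : ∀ S : R.Block, v ∈ S.1 → w ∈ S.1 →
        ∃ (S : R.Block) (i j : Fin n), v = S.vert i ∧ w = S.vert j := fun S hv hw =>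
      ⟨S, R.color v, R.color w, (S.vert_color hv).symm, (S.vert_color hw).symm⟩
    rcases le_total (R.depth v) (R.depth w) with hd | hd
    · rcases exists_block_or_leaf h hd with ⟨S, hv, hw⟩ | h
      · exact Or.inl (block S hv hw)
      · exact Or.inr (Or.inr h)
    · rcases exists_block_or_leaf h.symm hd with ⟨S, hw, hv⟩ | h
      · exact Or.inl (block S hv hw)
      · exact Or.inr (Or.inl h)
  exists_child S i hi := by
    refine (exists_child_or_leaf (R := R) (S.cut (S.vert_mem i))).imp_left ?_
    rintro ⟨S', h1, h2⟩
    exact ⟨S', h1, by rw [h2, hi], by rw [h2, S.color_vert]⟩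

end Home

end RootedTreeGraded

theorem NCliqueTreeGraded.nonempty_cliqueTree {V : Type} [Finite V] {Γ : SimpleGraph V} {n : ℕ}
    (h : NCliqueTreeGraded Γ n) (hn : 2 ≤ n) : Nonempty (CliqueTree Γ n) :=
  (h.nonempty_rooted hn).map fun R => R.cliqueTree

theorem CliqueTree.finite_move {V : Type} [Finite V] {Γ : SimpleGraph V} {n : ℕ}
    (Θ : CliqueTree Γ n) : Finite Θ.Move := by
  have := Θ.finite
  exact inferInstanceAs (Finite (({b // b ≠ Θ.root} ⊕ {u // Θ.leaf u}) × Bool))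

/-- Any two `n`-clique tree-graded RAAGs are quasi-isometric. -/
theorem stmt0 {n : ℕ} (hn : 2 ≤ n) {V W : Type} [Fintype V] [Fintype W]
    (Γ : SimpleGraph V) (Λ : SimpleGraph W)
    (hΓ : NCliqueTreeGraded Γ n) (hΛ : NCliqueTreeGraded Λ n) :
    RaagQI Γ Λ := by
  obtain ⟨Θ⟩ := hΓ.nonempty_cliqueTree hn
  obtain ⟨Θ'⟩ := hΛ.nonempty_cliqueTree hn
  have : Nontrivial (Fin n) := Fin.nontrivial_iff_two_le.2 hn
  have := Θ.finite_move
  have := Θ'.finite_move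
  let e := Finite.equivFin (Θ.Move ⊕ Θ'.Move)
  have h1 := Θ.coarseEquiv.trans
    (Θ.sys.coarseEquiv_regular (Function.Embedding.inl.trans e.toEmbedding))
  have h2 := Θ'.coarseEquiv.trans
    (Θ'.sys.coarseEquiv_regular (Function.Embedding.inr.trans e.toEmbedding))
  exact raagQI_of_coarseEquiv (h1.trans h2.symm)

end
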